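/- arXiv:1404.0170 — 3 statements merged into one kernel-verified Lean document; each statement's English description precedes it below -/
import Mathlib

section
/- The forgetful functor from the category of Poisson Hopf algebras over a field k to the category of coalgebras over k has a left adjoint, i.e. there exists a free Poisson Hopf algebra on every coalgebra. -/
open TensorProduct

universe u v w x

/-- A Poisson (bracket) structure on a commutative `k`-algebra `A`: a bilinear,
alternating bracket satisfying the Jacobi and Leibniz identities. -/
structure PoissonStr (k : Type u) (A : Type v) [CommRing k] [CommRing A] [Algebra k A] where
  br : A →ₗ[k] A →ₗ[k] A
  br_self : ∀ a : A, br a a = 0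
  jacobi : ∀ a b c : A, br a (br b c) = br (br a b) c + br b (br a c)
  leibniz : ∀ a b c : A, br a (b * c) = br a b * c + b * br a c

/-- `f` is a morphism of Poisson algebras. -/
def IsPoissonHom {k : Type u} {A : Type v} {B : Type w} [CommRing k]
    [CommRing A] [Algebra k A] [CommRing B] [Algebra k B]
    (PA : PoissonStr k A) (PB : PoissonStr k B) (f : A →ₐ[k] B) : Prop :=
  ∀ a b : A, f (PA.br a b) = PB.br (f a) (f b)

/-- `T` is the tensor-product Poisson structure on `A ⊗[k] B`. -/
def IsTensorPoissonStr {k : Type u} {A : Type v} {B : Type w} [CommRing k]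
    [CommRing A] [Algebra k A] [CommRing B] [Algebra k B]
    (PA : PoissonStr k A) (PB : PoissonStr k B) (T : PoissonStr k (A ⊗[k] B)) : Prop :=
  ∀ (p r : A) (q s : B),
    T.br (p ⊗ₜ[k] q) (r ⊗ₜ[k] s) = (p * r) ⊗ₜ[k] PB.br q s + PA.br p r ⊗ₜ[k] (q * s)

/-- A coalgebra structure (as data) on a `k`-module `C`. -/
structure CoalgData (k : Type u) (C : Type v) [CommRing k] [AddCommGroup C] [Module k C] where
  comul : C →ₗ[k] C ⊗[k] C
  counit : C →ₗ[k] k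
  coassoc : ∀ c : C, TensorProduct.map comul LinearMap.id (comul c) =
    (TensorProduct.assoc k C C C).symm (TensorProduct.map LinearMap.id comul (comul c))
  counit_comul : ∀ c : C,
    TensorProduct.lid k C (TensorProduct.map counit LinearMap.id (comul c)) = c
  comul_counit : ∀ c : C,
    TensorProduct.rid k C (TensorProduct.map LinearMap.id counit (comul c)) = c

/-- `f` is a morphism of coalgebras. -/
def IsCoalgHom {k : Type u} {C : Type v} {D : Type w} [CommRing k]
    [AddCommGroup C] [Module k C] [AddCommGroup D] [Module k D]
    (DC : CoalgData k C) (DD : CoalgData k D) (f : C →ₗ[k] D) : Prop :=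
  (∀ c : C, DD.comul (f c) = TensorProduct.map f f (DC.comul c)) ∧
  (∀ c : C, DD.counit (f c) = DC.counit c)

/-- A (commutative) bialgebra structure (as data) on a commutative `k`-algebra `B`:
the comultiplication and the counit are algebra maps, the coalgebra axioms hold. -/
structure BialgData (k : Type u) (B : Type v) [CommRing k] [CommRing B] [Algebra k B] where
  comul : B →ₐ[k] B ⊗[k] B
  counit : B →ₐ[k] k
  coassoc : ∀ b : B,
    TensorProduct.map comul.toLinearMap LinearMap.id (comul b) =
      (TensorProduct.assoc k B B B).symm (TensorProduct.map LinearMap.id comul.toLinearMap (comul b))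
  counit_comul : ∀ b : B,
    TensorProduct.lid k B (TensorProduct.map counit.toLinearMap LinearMap.id (comul b)) = b
  comul_counit : ∀ b : B,
    TensorProduct.rid k B (TensorProduct.map LinearMap.id counit.toLinearMap (comul b)) = b

/-- The underlying coalgebra of a bialgebra. -/
def BialgData.toCoalgData {k : Type u} {B : Type v} [CommRing k] [CommRing B] [Algebra k B]
    (D : BialgData k B) : CoalgData k B where
  comul := D.comul.toLinearMap
  counit := D.counit.toLinearMap
  coassoc := D.coassoc
  counit_comul := D.counit_comul
  comul_counit := D.comul_counit

/-- A Hopf algebra structure (as data): a bialgebra together with an antipode. -/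
structure HopfData (k : Type u) (B : Type v) [CommRing k] [CommRing B] [Algebra k B]
    extends BialgData k B where
  antipode : B →ₗ[k] B
  antipode_comul : ∀ b : B,
    LinearMap.mul' k B (TensorProduct.map antipode LinearMap.id (comul b)) =
      algebraMap k B (counit b)
  comul_antipode : ∀ b : B,
    LinearMap.mul' k B (TensorProduct.map LinearMap.id antipode (comul b)) =
      algebraMap k B (counit b)

/-- The bialgebra `D` together with the Poisson structure `PS` is a Poisson bialgebra:
the comultiplication is a morphism of Poisson algebras into `B ⊗ B` with the tensor
Poisson structure. -/
def IsPoissonBialg {k : Type u} {B : Type v} [CommRing k] [CommRing B] [Algebra k B]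
    (PS : PoissonStr k B) (D : BialgData k B) : Prop :=
  ∃ T : PoissonStr k (B ⊗[k] B), IsTensorPoissonStr PS PS T ∧
    ∀ a b : B, D.comul (PS.br a b) = T.br (D.comul a) (D.comul b)

/-- `f` is a morphism of Poisson bialgebras. -/
def IsPoissonBialgHom {k : Type u} {A : Type v} {B : Type w} [CommRing k]
    [CommRing A] [Algebra k A] [CommRing B] [Algebra k B]
    (PA : PoissonStr k A) (PB : PoissonStr k B)
    (DA : BialgData k A) (DB : BialgData k B) (f : A →ₐ[k] B) : Prop :=
  IsPoissonHom PA PB f ∧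
  (∀ a : A, DB.comul (f a) = TensorProduct.map f.toLinearMap f.toLinearMap (DA.comul a)) ∧
  (∀ a : A, DB.counit (f a) = DA.counit a)

/-- `f` is a morphism of Poisson bialgebras into the opposite-coopposite. -/
def IsOpPoissonBialgHom {k : Type u} {A : Type v} {B : Type w} [CommRing k]
    [CommRing A] [Algebra k A] [CommRing B] [Algebra k B]
    (PA : PoissonStr k A) (PB : PoissonStr k B)
    (DA : BialgData k A) (DB : BialgData k B) (f : A →ₐ[k] B) : Prop :=
  (∀ a b : A, f (PA.br a b) = PB.br (f b) (f a)) ∧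
  (∀ a : A, DB.comul (f a) =
    TensorProduct.comm k B B (TensorProduct.map f.toLinearMap f.toLinearMap (DA.comul a))) ∧
  (∀ a : A, DB.counit (f a) = DA.counit a)

/-- A Poisson ideal: an associative ideal which is also a Lie ideal. -/
def IsPoissonIdeal {k : Type u} {Q : Type v} [CommRing k] [CommRing Q] [Algebra k Q]
    (PS : PoissonStr k Q) (I : Ideal Q) : Prop :=
  ∀ p : Q, ∀ a ∈ I, PS.br p a ∈ I

/-- The Poisson ideal generated by a set. -/
def poissonIdealGen {k : Type u} {Q : Type v} [CommRing k] [CommRing Q] [Algebra k Q]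
    (PS : PoissonStr k Q) (S : Set Q) : Ideal Q :=
  sInf {I : Ideal Q | S ⊆ I ∧ IsPoissonIdeal PS I}

/-- The subspace `Q ⊗ I + I ⊗ Q` of `Q ⊗ Q`. -/
def sweedlerSpan {k : Type u} {Q : Type v} [CommRing k] [CommRing Q] [Algebra k Q]
    (I : Submodule k Q) : Submodule k (Q ⊗[k] Q) :=
  LinearMap.range (TensorProduct.map LinearMap.id I.subtype) ⊔
    LinearMap.range (TensorProduct.map I.subtype LinearMap.id)

/-- A bundled Poisson algebra. -/
structure PoissonAlgBundle (k : Type u) [CommRing k] where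
  carrier : Type v
  [ring : CommRing carrier]
  [alg : Algebra k carrier]
  str : PoissonStr k carrier

attribute [instance] PoissonAlgBundle.ring PoissonAlgBundle.alg

/-- A bundled Poisson bialgebra. -/
structure PoissonBialgBundle (k : Type u) [CommRing k] extends PoissonAlgBundle.{u, v} k where
  bi : BialgData k carrier
  compat : IsPoissonBialg str bi

/-- A bundled Poisson Hopf algebra. -/
structure PoissonHopfBundle (k : Type u) [CommRing k] extends PoissonAlgBundle.{u, v} k where
  hopf : HopfData k carrier
  compat : IsPoissonBialg str hopf.toBialgData

namespace FPH

theorem br_skew {k : Type u} {A : Type v} [CommRing k] [CommRing A] [Algebra k A]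
    (P : PoissonStr k A) (a b : A) : P.br a b = - P.br b a := by
  have h := P.br_self (a + b)
  simp only [map_add, LinearMap.add_apply, P.br_self, zero_add, add_zero] at h
  exact eq_neg_of_add_eq_zero_right h

theorem leibniz_left {k : Type u} {A : Type v} [CommRing k] [CommRing A] [Algebra k A]
    (P : PoissonStr k A) (a b c : A) : P.br (a * b) c = a * P.br b c + P.br a c * b := by
  rw [br_skew, P.leibniz, br_skew P c a, br_skew P c b]; ring

theorem br_one {k : Type u} {A : Type v} [CommRing k] [CommRing A] [Algebra k A]
    (P : PoissonStr k A) (a : A) : P.br a 1 = 0 := by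
  have h := P.leibniz a 1 1
  simpa using h

theorem br_alg {k : Type u} {A : Type v} [CommRing k] [CommRing A] [Algebra k A]
    (P : PoissonStr k A) (a : A) (r : k) : P.br a (algebraMap k A r) = 0 := by
  rw [Algebra.algebraMap_eq_smul_one, map_smul, br_one, smul_zero]

theorem alg_br {k : Type u} {A : Type v} [CommRing k] [CommRing A] [Algebra k A]
    (P : PoissonStr k A) (a : A) (r : k) : P.br (algebraMap k A r) a = 0 := by
  rw [br_skew, br_alg, neg_zero]

section tensor
variable {k : Type u} {A : Type v} {B : Type w} [CommRing k] [CommRing A] [Algebra k A]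
  [CommRing B] [Algebra k B] (PA : PoissonStr k A) (PB : PoissonStr k B)

/-- the tensor bracket -/
noncomputable def tbr : A ⊗[k] B →ₗ[k] A ⊗[k] B →ₗ[k] A ⊗[k] B :=
  TensorProduct.map₂ (LinearMap.mul k A) PB.br + TensorProduct.map₂ PA.br (LinearMap.mul k B)

theorem tbr_tmul (p r : A) (q s : B) : tbr PA PB (p ⊗ₜ[k] q) (r ⊗ₜ[k] s)
    = (p * r) ⊗ₜ[k] PB.br q s + PA.br p r ⊗ₜ[k] (q * s) := by
  simp [tbr]

theorem tbr_skew (x y : A ⊗[k] B) : tbr PA PB x y = - tbr PA PB y x := by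
  induction x using TensorProduct.induction_on with
  | zero => simp
  | add x x' hx hx' => simp only [map_add, LinearMap.add_apply, hx, hx']; abel
  | tmul p q =>
    induction y using TensorProduct.induction_on with
    | zero => simp
    | add x x' hx hx' => simp only [map_add, LinearMap.add_apply, hx, hx']; abel
    | tmul r s =>
      rw [tbr_tmul, tbr_tmul, br_skew PA r p, br_skew PB s q, mul_comm r, mul_comm s,
        TensorProduct.tmul_neg, TensorProduct.neg_tmul]; abel

/-- the tensor Poisson structure -/
noncomputable def tensorP : PoissonStr k (A ⊗[k] B) where
  br := tbr PA PB
  br_self x := by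
    induction x using TensorProduct.induction_on with
    | zero => simp
    | add x y hx hy =>
      simp only [map_add, LinearMap.add_apply, hx, hy]
      rw [tbr_skew PA PB x y]; abel
    | tmul p q => simp [tbr_tmul, PA.br_self, PB.br_self]
  jacobi x y z := by
    induction x using TensorProduct.induction_on with
    | zero => simp
    | add x x' hx hx' => simp only [map_add, LinearMap.add_apply, hx, hx']; abel
    | tmul p q =>
    induction y using TensorProduct.induction_on with
    | zero => simp
    | add x x' hx hx' => simp only [map_add, LinearMap.add_apply, hx, hx']; abel
    | tmul r s =>
    induction z using TensorProduct.induction_on with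
    | zero => simp
    | add x x' hx hx' => simp only [map_add, hx, hx']; abel
    | tmul t v =>
      simp only [tbr_tmul, map_add, LinearMap.add_apply, PA.leibniz, PB.leibniz, leibniz_left]
      rw [PA.jacobi p r t, PB.jacobi q s v, br_skew PA r p, br_skew PB s q]
      simp only [TensorProduct.tmul_add, TensorProduct.add_tmul, TensorProduct.tmul_neg,
        TensorProduct.neg_tmul, neg_mul, mul_neg, mul_comm, mul_left_comm]
      abel
  leibniz x y z := by
    induction x using TensorProduct.induction_on with
    | zero => simp
    | add x x' hx hx' => simp only [map_add, LinearMap.add_apply, hx, hx']; ring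
    | tmul p q =>
    induction y using TensorProduct.induction_on with
    | zero => simp
    | add x x' hx hx' => simp only [map_add, add_mul, hx, hx']; ring
    | tmul r s =>
    induction z using TensorProduct.induction_on with
    | zero => simp
    | add x x' hx hx' => simp only [map_add, mul_add, hx, hx']; ring
    | tmul t v =>
      simp only [tbr_tmul, Algebra.TensorProduct.tmul_mul_tmul, PA.leibniz, PB.leibniz,
        TensorProduct.tmul_add, TensorProduct.add_tmul, add_mul, mul_add,
        mul_comm, mul_left_comm]
      abel

theorem tensorP_is : IsTensorPoissonStr PA PB (tensorP PA PB) := fun p r q s => tbr_tmul PA PB p r q s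

theorem tensor_unique (T : PoissonStr k (A ⊗[k] B)) (hT : IsTensorPoissonStr PA PB T) :
    T.br = tbr PA PB := by
  apply TensorProduct.ext'
  intro p q
  apply TensorProduct.ext'
  intro r s
  rw [hT, tbr_tmul]

end tensor

/-- Poisson-compatibility of a linear map out of a tensor product need only be checked on pure
tensors. -/
theorem poisson_of_tmul {k : Type u} {A : Type v} {B : Type w} {Q : Type x} [CommRing k]
    [CommRing A] [Algebra k A] [CommRing B] [Algebra k B] [CommRing Q] [Algebra k Q]
    (PA : PoissonStr k A) (PB : PoissonStr k B) (PQ : PoissonStr k Q) (f : A ⊗[k] B →ₗ[k] Q)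
    (h : ∀ p q r s, f (tbr PA PB (p ⊗ₜ[k] q) (r ⊗ₜ[k] s)) = PQ.br (f (p ⊗ₜ q)) (f (r ⊗ₜ s)))
    (x y : A ⊗[k] B) : f (tbr PA PB x y) = PQ.br (f x) (f y) := by
  induction x using TensorProduct.induction_on with
  | zero => simp
  | add x x' hx hx' => simp only [map_add, LinearMap.add_apply, hx, hx']
  | tmul p q =>
    induction y using TensorProduct.induction_on with
    | zero => simp
    | add x x' hx hx' => simp only [map_add, hx, hx']
    | tmul r s => exact h p q r s

theorem poisson_map {k : Type u} {A B A' B' : Type*} [CommRing k]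
    [CommRing A] [Algebra k A] [CommRing B] [Algebra k B]
    [CommRing A'] [Algebra k A'] [CommRing B'] [Algebra k B']
    {PA : PoissonStr k A} {PB : PoissonStr k B} {PA' : PoissonStr k A'} {PB' : PoissonStr k B'}
    {f : A →ₐ[k] A'} {g : B →ₐ[k] B'} (hf : IsPoissonHom PA PA' f) (hg : IsPoissonHom PB PB' g) :
    IsPoissonHom (tensorP PA PB) (tensorP PA' PB') (Algebra.TensorProduct.map f g) := by
  intro x y
  refine poisson_of_tmul PA PB (tensorP PA' PB') (Algebra.TensorProduct.map f g).toLinearMap ?_ x y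
  intro p q r s
  simp only [AlgHom.toLinearMap_apply, tbr_tmul, map_add, Algebra.TensorProduct.map_tmul, map_mul,
    hf p r, hg q s, tensorP]

theorem poisson_assoc_symm {k : Type u} {A B D : Type*} [CommRing k]
    [CommRing A] [Algebra k A] [CommRing B] [Algebra k B] [CommRing D] [Algebra k D]
    (PA : PoissonStr k A) (PB : PoissonStr k B) (PD : PoissonStr k D) :
    IsPoissonHom (tensorP PA (tensorP PB PD)) (tensorP (tensorP PA PB) PD)
      (Algebra.TensorProduct.assoc k k k A B D).symm.toAlgHom := by
  intro x y
  refine poisson_of_tmul PA (tensorP PB PD) (tensorP (tensorP PA PB) PD)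
    (Algebra.TensorProduct.assoc k k k A B D).symm.toAlgHom.toLinearMap ?_ x y
  intro p q r s
  induction q using TensorProduct.induction_on with
  | zero => simp
  | add x x' hx hx' =>
    simp only [TensorProduct.tmul_add, map_add, LinearMap.add_apply, hx, hx']
  | tmul q q' =>
  induction s using TensorProduct.induction_on with
  | zero => simp
  | add x x' hx hx' =>
    simp only [TensorProduct.tmul_add, map_add, hx, hx']
  | tmul s s' =>
    simp [tbr_tmul, tensorP, TensorProduct.tmul_add, TensorProduct.add_tmul, add_assoc]

/-- zero bracket -/
def zeroP (k : Type u) (A : Type v) [CommRing k] [CommRing A] [Algebra k A] : PoissonStr k A where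
  br := 0
  br_self := by simp
  jacobi := by simp
  leibniz := by simp

/-- opposite bracket -/
def opP {k : Type u} {A : Type v} [CommRing k] [CommRing A] [Algebra k A] (P : PoissonStr k A) :
    PoissonStr k A where
  br := - P.br
  br_self a := by simp [P.br_self]
  jacobi a b c := by simp [P.jacobi a b c]
  leibniz a b c := by simp [P.leibniz a b c]; ring

theorem poisson_lid {k : Type u} {A : Type*} [CommRing k] [CommRing A] [Algebra k A]
    (PA : PoissonStr k A) :
    IsPoissonHom (tensorP (zeroP k k) PA) PA (Algebra.TensorProduct.lid k A).toAlgHom := by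
  intro x y
  refine poisson_of_tmul (zeroP k k) PA PA (Algebra.TensorProduct.lid k A).toAlgHom.toLinearMap ?_ x y
  intro p q r s
  simp [tbr_tmul, zeroP, smul_smul, mul_comm]

theorem poisson_rid {k : Type u} {A : Type*} [CommRing k] [CommRing A] [Algebra k A]
    (PA : PoissonStr k A) :
    IsPoissonHom (tensorP PA (zeroP k k)) PA (Algebra.TensorProduct.rid k k A).toAlgHom := by
  intro x y
  refine poisson_of_tmul PA (zeroP k k) PA (Algebra.TensorProduct.rid k k A).toAlgHom.toLinearMap ?_ x y
  intro p q r s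
  simp [tbr_tmul, zeroP, smul_smul, mul_comm]

/-- the counit of a Poisson bialgebra is Poisson -/
theorem counit_poisson {k : Type u} {B : Type v} [CommRing k] [CommRing B] [Algebra k B]
    (PS : PoissonStr k B) (D : BialgData k B) (h : IsPoissonBialg PS D) :
    IsPoissonHom PS (zeroP k k) D.counit := by
  obtain ⟨T, hT, hc⟩ := h
  -- the key identity
  have key : ∀ x y : B ⊗[k] B,
      D.counit (TensorProduct.lid k B (TensorProduct.map D.counit.toLinearMap LinearMap.id
        (tbr PS PS x y))) =
      D.counit (PS.br (TensorProduct.lid k B (TensorProduct.map D.counit.toLinearMap LinearMap.id x))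
        (TensorProduct.lid k B (TensorProduct.map D.counit.toLinearMap LinearMap.id y))) +
      D.counit (PS.br (TensorProduct.rid k B (TensorProduct.map LinearMap.id D.counit.toLinearMap x))
        (TensorProduct.rid k B (TensorProduct.map LinearMap.id D.counit.toLinearMap y))) := by
    intro x y
    induction x using TensorProduct.induction_on with
    | zero => simp
    | add x x' hx hx' => simp only [map_add, LinearMap.add_apply, hx, hx']; ring
    | tmul p q =>
    induction y using TensorProduct.induction_on with
    | zero => simp
    | add x x' hx hx' => simp only [map_add, hx, hx']; ring
    | tmul r s => simp [tbr_tmul]; ring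
  intro a b
  have h1 := key (D.comul a) (D.comul b)
  rw [← tensor_unique PS PS T hT, ← hc, D.counit_comul, D.counit_comul, D.counit_comul,
    D.comul_counit, D.comul_counit] at h1
  simp only [zeroP, LinearMap.zero_apply]
  exact left_eq_add.mp h1

end FPH

namespace FPH
open WithConv

section conv
variable {k : Type u} {C : Type v} [CommRing k] [AddCommGroup C] [Module k C] [Coalgebra k C]

/-- `f` and `g` are convolution inverse. -/
def ConvInv {A : Type w} [CommRing A] [Algebra k A] (f g : C →ₗ[k] A) : Prop :=
  toConv f * toConv g = 1 ∧ toConv g * toConv f = 1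

variable {A : Type w} [CommRing A] [Algebra k A] {B : Type x} [CommRing B] [Algebra k B]

theorem convInv_iff (f g : C →ₗ[k] A) : ConvInv f g ↔
    (∀ c, LinearMap.mul' k A (TensorProduct.map f g (Coalgebra.comul (R := k) c)) =
      algebraMap k A (Coalgebra.counit (R := k) c)) ∧
    (∀ c, LinearMap.mul' k A (TensorProduct.map g f (Coalgebra.comul (R := k) c)) =
      algebraMap k A (Coalgebra.counit (R := k) c)) := by
  constructor
  · rintro ⟨h1, h2⟩
    exact ⟨fun c => LinearMap.congr_fun (congrArg ofConv h1) c,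
      fun c => LinearMap.congr_fun (congrArg ofConv h2) c⟩
  · rintro ⟨h1, h2⟩
    exact ⟨WithConv.ext (LinearMap.ext h1), WithConv.ext (LinearMap.ext h2)⟩

theorem ConvInv.symm {f g : C →ₗ[k] A} (h : ConvInv f g) : ConvInv g f := ⟨h.2, h.1⟩

theorem ConvInv.unique {f g g' : C →ₗ[k] A} (h : ConvInv f g) (h' : ConvInv f g') : g = g' :=
  toConv_injective (left_inv_eq_right_inv h.2 h'.1)

theorem comp_mul_conv (φ : A →ₐ[k] B) (f g : C →ₗ[k] A) :
    toConv (φ.toLinearMap ∘ₗ f) * toConv (φ.toLinearMap ∘ₗ g) =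
      toConv (φ.toLinearMap ∘ₗ (toConv f * toConv g).ofConv) := by
  rw [LinearMap.algHom_comp_convMul_distrib]

theorem comp_one_conv (φ : A →ₐ[k] B) :
    toConv (φ.toLinearMap ∘ₗ (1 : WithConv (C →ₗ[k] A)).ofConv) = 1 := by
  apply WithConv.ext
  ext c
  simp [LinearMap.convOne_def]

theorem ConvInv.comp {f g : C →ₗ[k] A} (h : ConvInv f g) (φ : A →ₐ[k] B) :
    ConvInv (φ.toLinearMap ∘ₗ f) (φ.toLinearMap ∘ₗ g) := by
  constructor
  · rw [comp_mul_conv, h.1, comp_one_conv]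
  · rw [comp_mul_conv, h.2, comp_one_conv]

theorem ConvInv.mul {f g f' g' : C →ₗ[k] A} (h : ConvInv f g) (h' : ConvInv f' g') :
    ConvInv (toConv f * toConv f').ofConv (toConv g' * toConv g).ofConv := by
  constructor
  · simp only [toConv_ofConv]
    rw [mul_assoc, ← mul_assoc (toConv f'), h'.1, one_mul, h.1]
  · simp only [toConv_ofConv]
    rw [mul_assoc, ← mul_assoc (toConv g), h.2, one_mul, h'.2]

theorem ConvInv.tensor {f g : C →ₗ[k] A} (h : ConvInv f g) :
    ∃ G : C →ₗ[k] A ⊗[k] A, ConvInv (TensorProduct.map f f ∘ₗ Coalgebra.comul) G := by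
  have h1 := (h.comp (Algebra.TensorProduct.includeLeft (R := k) (S := k) (A := A) (B := A))).mul
    (h.comp (Algebra.TensorProduct.includeRight (R := k) (A := A) (B := A)))
  have e : TensorProduct.map f f ∘ₗ Coalgebra.comul =
      (toConv ((Algebra.TensorProduct.includeLeft (R := k) (S := k) (A := A) (B := A)).toLinearMap ∘ₗ f)
      * toConv ((Algebra.TensorProduct.includeRight (R := k) (A := A) (B := A)).toLinearMap ∘ₗ f)).ofConv
      := by
    rw [LinearMap.convMul_def]
    simp only [ofConv_toConv]
    rw [← LinearMap.comp_assoc]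
    congr 1
    ext a b
    simp
  rw [e]
  exact ⟨_, h1⟩

end conv

/-- terms -/
inductive Tm (k : Type u) (C : Type u) : Type u
  | i : C → Tm k C
  | j : C → Tm k C
  | c : k → Tm k C
  | add : Tm k C → Tm k C → Tm k C
  | mul : Tm k C → Tm k C → Tm k C
  | br : Tm k C → Tm k C → Tm k C

section free
variable (k : Type u) (C : Type u) [CommRing k] [AddCommGroup C] [Module k C] [Coalgebra k C]

/-- A target: a Poisson algebra with a convolution invertible map. -/
structure Model where
  alg : PoissonAlgBundle.{u, u} k
  f : C →ₗ[k] alg.carrier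
  g : C →ₗ[k] alg.carrier
  inv : ConvInv f g

variable {k C}

/-- evaluation of terms -/
def Model.eval (M : Model k C) : Tm k C → M.alg.carrier
  | .i c => M.f c
  | .j c => M.g c
  | .c r => algebraMap k _ r
  | .add s t => M.eval s + M.eval t
  | .mul s t => M.eval s * M.eval t
  | .br s t => M.alg.str.br (M.eval s) (M.eval t)

variable (k C)

/-- semantic equality -/
def tmSetoid : Setoid (Tm k C) where
  r s t := ∀ M : Model k C, M.eval s = M.eval t
  iseqv := ⟨fun _ _ => rfl, fun h M => (h M).symm, fun h hh M => (h M).trans (hh M)⟩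

/-- The free object. -/
def Fr : Type u := Quotient (tmSetoid k C)

variable {k C}

/-- class of a term -/
def Fr.mk (t : Tm k C) : Fr k C := Quotient.mk (tmSetoid k C) t

theorem Fr.ind {p : Fr k C → Prop} (h : ∀ t, p (Fr.mk t)) (x : Fr k C) : p x := Quotient.ind h x

theorem Fr.sound {s t : Tm k C} (h : ∀ M : Model k C, M.eval s = M.eval t) : Fr.mk s = Fr.mk t :=
  Quotient.sound (s := tmSetoid k C) h

/-- evaluation on the quotient -/
def Model.ev (M : Model k C) : Fr k C → M.alg.carrier :=
  Quotient.lift M.eval (fun _ _ h => h M)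

theorem Model.ev_mk (M : Model k C) (t : Tm k C) : M.ev (Fr.mk t) = M.eval t := rfl

theorem Fr.ext {x y : Fr k C} (h : ∀ M : Model k C, M.ev x = M.ev y) : x = y := by
  induction x using Fr.ind
  induction y using Fr.ind
  exact Fr.sound h

/-- a binary operation -/
def Fr.op (o : Tm k C → Tm k C → Tm k C)
    (ho : ∀ s s' t t', (∀ M : Model k C, M.eval s = M.eval s') →
      (∀ M : Model k C, M.eval t = M.eval t') → ∀ M : Model k C, M.eval (o s t) = M.eval (o s' t')) :
    Fr k C → Fr k C → Fr k C :=
  Quotient.map₂ o (fun _ _ h _ _ h' => ho _ _ _ _ h h')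

instance : Add (Fr k C) := ⟨Fr.op .add (fun _ _ _ _ h h' M => by simp [Model.eval, h M, h' M])⟩
instance : Mul (Fr k C) := ⟨Fr.op .mul (fun _ _ _ _ h h' M => by simp [Model.eval, h M, h' M])⟩
instance : Zero (Fr k C) := ⟨Fr.mk (.c 0)⟩
instance : One (Fr k C) := ⟨Fr.mk (.c 1)⟩
instance : Neg (Fr k C) := ⟨fun x => Fr.mk (.c (-1)) * x⟩

/-- the bracket as a function -/
def Fr.brf : Fr k C → Fr k C → Fr k C :=
  Fr.op .br (fun _ _ _ _ h h' M => by simp [Model.eval, h M, h' M])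

theorem Model.ev_add (M : Model k C) (x y : Fr k C) : M.ev (x + y) = M.ev x + M.ev y := by
  induction x using Fr.ind
  induction y using Fr.ind
  rfl
theorem Model.ev_mul (M : Model k C) (x y : Fr k C) : M.ev (x * y) = M.ev x * M.ev y := by
  induction x using Fr.ind
  induction y using Fr.ind
  rfl
theorem Model.ev_brf (M : Model k C) (x y : Fr k C) :
    M.ev (x.brf y) = M.alg.str.br (M.ev x) (M.ev y) := by
  induction x using Fr.ind
  induction y using Fr.ind
  rfl
theorem Model.ev_c (M : Model k C) (r : k) : M.ev (Fr.mk (.c r)) = algebraMap k _ r := rfl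
theorem Model.ev_i (M : Model k C) (r : C) : M.ev (Fr.mk (.i r)) = M.f r := rfl
theorem Model.ev_j (M : Model k C) (r : C) : M.ev (Fr.mk (.j r)) = M.g r := rfl
theorem Model.ev_zero (M : Model k C) : M.ev 0 = 0 := (M.ev_c 0).trans (map_zero _)
theorem Model.ev_one (M : Model k C) : M.ev 1 = 1 := (M.ev_c 1).trans (map_one _)
theorem Model.ev_neg (M : Model k C) (x : Fr k C) : M.ev (-x) = - M.ev x := by
  change M.ev (Fr.mk (.c (-1)) * x) = _
  rw [ev_mul, ev_c]; simp

instance : CommRing (Fr k C) where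
  add_assoc a b c := Fr.ext fun M => by simp only [Model.ev_add]; ring
  zero_add a := Fr.ext fun M => by simp only [Model.ev_add, Model.ev_zero]; ring
  add_zero a := Fr.ext fun M => by simp only [Model.ev_add, Model.ev_zero]; ring
  add_comm a b := Fr.ext fun M => by simp only [Model.ev_add]; ring
  left_distrib a b c := Fr.ext fun M => by simp only [Model.ev_add, Model.ev_mul]; ring
  right_distrib a b c := Fr.ext fun M => by simp only [Model.ev_add, Model.ev_mul]; ring
  zero_mul a := Fr.ext fun M => by simp only [Model.ev_mul, Model.ev_zero]; ring
  mul_zero a := Fr.ext fun M => by simp only [Model.ev_mul, Model.ev_zero]; ring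
  mul_assoc a b c := Fr.ext fun M => by simp only [Model.ev_mul]; ring
  one_mul a := Fr.ext fun M => by simp only [Model.ev_mul, Model.ev_one]; ring
  mul_one a := Fr.ext fun M => by simp only [Model.ev_mul, Model.ev_one]; ring
  neg_add_cancel a := Fr.ext fun M => by
    simp only [Model.ev_add, Model.ev_neg, Model.ev_zero]; ring
  mul_comm a b := Fr.ext fun M => by simp only [Model.ev_mul]; ring
  nsmul := nsmulRec
  zsmul := zsmulRec

instance : Algebra k (Fr k C) := RingHom.toAlgebra
  { toFun := fun r => Fr.mk (.c r)
    map_one' := rfl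
    map_zero' := rfl
    map_add' := fun r s => Fr.ext fun M => by simp only [Model.ev_add, Model.ev_c, map_add]
    map_mul' := fun r s => Fr.ext fun M => by simp only [Model.ev_mul, Model.ev_c, map_mul] }

theorem Fr.algebraMap_def (r : k) : algebraMap k (Fr k C) r = Fr.mk (.c r) := rfl

/-- evaluation as an algebra map -/
def Model.hom (M : Model k C) : Fr k C →ₐ[k] M.alg.carrier where
  toFun := M.ev
  map_one' := M.ev_one
  map_mul' := M.ev_mul
  map_zero' := M.ev_zero
  map_add' := M.ev_add
  commutes' r := rfl

theorem Model.ev_smul (M : Model k C) (r : k) (x : Fr k C) : M.ev (r • x) = r • M.ev x :=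
  map_smul M.hom r x

variable (k C)

/-- Poisson structure on the free object -/
def Fr.str : PoissonStr k (Fr k C) where
  br := LinearMap.mk₂ k Fr.brf
    (fun a b c => Fr.ext fun M => by
      simp only [Model.ev_brf, Model.ev_add, map_add, LinearMap.add_apply])
    (fun a b c => Fr.ext fun M => by
      simp only [Model.ev_brf, Model.ev_smul, map_smul, LinearMap.smul_apply])
    (fun a b c => Fr.ext fun M => by simp only [Model.ev_brf, Model.ev_add, map_add])
    (fun a b c => Fr.ext fun M => by simp only [Model.ev_brf, Model.ev_smul, map_smul])
  br_self a := Fr.ext fun M => by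
    simp only [LinearMap.mk₂_apply, Model.ev_brf, Model.ev_zero, M.alg.str.br_self]
  jacobi a b c := Fr.ext fun M => by
    simp only [LinearMap.mk₂_apply, Model.ev_brf, Model.ev_add]
    exact M.alg.str.jacobi _ _ _
  leibniz a b c := Fr.ext fun M => by
    simp only [LinearMap.mk₂_apply, Model.ev_brf, Model.ev_add, Model.ev_mul, M.alg.str.leibniz]

/-- first generator map -/
def Fr.i : C →ₗ[k] Fr k C where
  toFun c := Fr.mk (.i c)
  map_add' a b := Fr.ext fun M => by simp only [Model.ev_add, Model.ev_i, map_add]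
  map_smul' a b := Fr.ext fun M => by
    simp only [Model.ev_smul, Model.ev_i, map_smul, RingHom.id_apply]

/-- second generator map -/
def Fr.j : C →ₗ[k] Fr k C where
  toFun c := Fr.mk (.j c)
  map_add' a b := Fr.ext fun M => by simp only [Model.ev_add, Model.ev_j, map_add]
  map_smul' a b := Fr.ext fun M => by
    simp only [Model.ev_smul, Model.ev_j, map_smul, RingHom.id_apply]

variable {k C}

theorem Model.hom_poisson (M : Model k C) : IsPoissonHom (Fr.str k C) M.alg.str M.hom :=
  fun a b => M.ev_brf a b

theorem Model.hom_i (M : Model k C) : M.hom.toLinearMap ∘ₗ Fr.i k C = M.f := rfl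
theorem Model.hom_j (M : Model k C) : M.hom.toLinearMap ∘ₗ Fr.j k C = M.g := rfl

variable (k C)

theorem Fr.inv : ConvInv (Fr.i k C) (Fr.j k C) := by
  rw [convInv_iff]
  have hm : ∀ (M : Model k C) (p q : C →ₗ[k] Fr k C) (t : C ⊗[k] C),
      M.ev (LinearMap.mul' k _ (TensorProduct.map p q t)) =
      LinearMap.mul' k _ (TensorProduct.map (M.hom.toLinearMap ∘ₗ p) (M.hom.toLinearMap ∘ₗ q) t) := by
    intro M p q t
    change M.hom _ = _
    induction t using TensorProduct.induction_on with
    | zero => simp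
    | add x y hx hy => simp only [map_add, hx, hy]
    | tmul a b => simp
  constructor
  · intro c
    refine Fr.ext fun M => ?_
    rw [hm, M.hom_i, M.hom_j]
    exact ((convInv_iff _ _).1 M.inv).1 c
  · intro c
    refine Fr.ext fun M => ?_
    rw [hm, M.hom_i, M.hom_j]
    exact ((convInv_iff _ _).1 M.inv).2 c

variable {k C}

theorem Fr.hom_ext {Q : Type w} [CommRing Q] [Algebra k Q] (α β : Fr k C →ₐ[k] Q)
    (hi : α.toLinearMap ∘ₗ Fr.i k C = β.toLinearMap ∘ₗ Fr.i k C)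
    (hbr : ∀ a b, α a = β a → α b = β b → α ((Fr.str k C).br a b) = β ((Fr.str k C).br a b)) :
    α = β := by
  have hj : α.toLinearMap ∘ₗ Fr.j k C = β.toLinearMap ∘ₗ Fr.j k C := by
    refine ConvInv.unique ((Fr.inv k C).comp α) ?_
    rw [hi]
    exact (Fr.inv k C).comp β
  ext x
  induction x using Fr.ind with | h t =>
  induction t with
  | i c => exact LinearMap.congr_fun hi c
  | j c => exact LinearMap.congr_fun hj c
  | c r => exact (α.commutes r).trans (β.commutes r).symm
  | add s t hs ht =>
    change α (Fr.mk s + Fr.mk t) = β (Fr.mk s + Fr.mk t)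
    rw [map_add, map_add, hs, ht]
  | mul s t hs ht =>
    change α (Fr.mk s * Fr.mk t) = β (Fr.mk s * Fr.mk t)
    rw [map_mul, map_mul, hs, ht]
  | br s t hs ht => exact hbr _ _ hs ht

theorem Fr.poisson_ext {Q : Type w} [CommRing Q] [Algebra k Q] (PQ : PoissonStr k Q)
    {α β : Fr k C →ₐ[k] Q} (hα : IsPoissonHom (Fr.str k C) PQ α)
    (hβ : IsPoissonHom (Fr.str k C) PQ β)
    (hi : α.toLinearMap ∘ₗ Fr.i k C = β.toLinearMap ∘ₗ Fr.i k C) : α = β :=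
  Fr.hom_ext α β hi fun a b ha hb => by rw [hα, hβ, ha, hb]

theorem Fr.lift {Q : Type u} [CommRing Q] [Algebra k Q] (PQ : PoissonStr k Q)
    {f g : C →ₗ[k] Q} (h : ConvInv f g) :
    ∃ φ : Fr k C →ₐ[k] Q, IsPoissonHom (Fr.str k C) PQ φ ∧ φ.toLinearMap ∘ₗ Fr.i k C = f ∧
      φ.toLinearMap ∘ₗ Fr.j k C = g :=
  ⟨(Model.mk ⟨Q, PQ⟩ f g h).hom, Model.hom_poisson _, rfl, rfl⟩

end free
end FPH

namespace FPH

theorem poisson_comp {k : Type u} {A B D : Type*} [CommRing k]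
    [CommRing A] [Algebra k A] [CommRing B] [Algebra k B] [CommRing D] [Algebra k D]
    {PA : PoissonStr k A} {PB : PoissonStr k B} {PD : PoissonStr k D}
    {f : A →ₐ[k] B} {g : B →ₐ[k] D} (hg : IsPoissonHom PB PD g) (hf : IsPoissonHom PA PB f) :
    IsPoissonHom PA PD (g.comp f) := fun a b => by
  rw [AlgHom.comp_apply, hf, hg]; rfl

theorem poisson_id {k : Type u} {A : Type*} [CommRing k] [CommRing A] [Algebra k A]
    (PA : PoissonStr k A) : IsPoissonHom PA PA (AlgHom.id k A) := fun _ _ => rfl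

/-- The key antipode identity. -/
theorem antipode_key {k : Type u} {A : Type v} [CommRing k] [CommRing A] [Algebra k A]
    (P : PoissonStr k A) (S : A →ₐ[k] A) (hS : IsPoissonHom P (opP P) S) (x y : A ⊗[k] A) :
    Algebra.TensorProduct.productMap S (AlgHom.id k A) (tbr P P x y) =
      LinearMap.mul' k A (TensorProduct.map S.toLinearMap
        (P.br (Algebra.TensorProduct.productMap S (AlgHom.id k A) x)) y) +
      LinearMap.mul' k A (TensorProduct.map
        (P.br (Algebra.TensorProduct.productMap S (AlgHom.id k A) y) ∘ₗ S.toLinearMap)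
        LinearMap.id x) := by
  induction x using TensorProduct.induction_on with
  | zero => simp
  | add x x' hx hx' =>
    simp only [map_add, LinearMap.add_apply, hx, hx', TensorProduct.map_add_right]; ring
  | tmul p q =>
  induction y using TensorProduct.induction_on with
  | zero => simp
  | add x x' hx hx' =>
    simp only [map_add, hx, hx', LinearMap.add_comp, TensorProduct.map_add_left,
      LinearMap.add_apply]; ring
  | tmul r s =>
    have h := hS p r
    simp only [opP, LinearMap.neg_apply] at h
    simp [tbr_tmul, leibniz_left, h, br_skew P s (S p), br_skew P (S r) (S p)]
    ring

variable {k : Type u} {C : Type u} [CommRing k] [AddCommGroup C] [Module k C]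

/-- the Mathlib coalgebra of a `CoalgData` -/
@[reducible] def coalg (DC : CoalgData k C) : Coalgebra k C where
  comul := DC.comul
  counit := DC.counit
  coassoc := by
    ext c
    have h := DC.coassoc c
    rw [LinearEquiv.eq_symm_apply] at h
    exact h
  rTensor_counit_comp_comul := by
    ext c
    have h := DC.counit_comul c
    rw [← LinearEquiv.eq_symm_apply] at h
    exact h
  lTensor_counit_comp_comul := by
    ext c
    have h := DC.comul_counit c
    rw [← LinearEquiv.eq_symm_apply] at h
    exact h

theorem exists_hopf [Coalgebra k C] : ∃ (H : HopfData k (Fr k C)),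
    IsPoissonBialg (Fr.str k C) H.toBialgData ∧
    H.comul.toLinearMap ∘ₗ Fr.i k C =
      TensorProduct.map (Fr.i k C) (Fr.i k C) ∘ₗ Coalgebra.comul ∧
    H.counit.toLinearMap ∘ₗ Fr.i k C = Coalgebra.counit := by
  obtain ⟨G, hG⟩ := (Fr.inv k C).tensor
  obtain ⟨Δ, hΔ, hΔi, -⟩ := Fr.lift (tensorP (Fr.str k C) (Fr.str k C)) hG
  have hone : ConvInv (Coalgebra.counit : C →ₗ[k] k) Coalgebra.counit := by
    have : WithConv.toConv (Coalgebra.counit : C →ₗ[k] k) = 1 := by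
      apply WithConv.ext; ext c; simp [LinearMap.convOne_def]
    constructor <;> rw [this, one_mul]
  obtain ⟨ε, hε, hεi, -⟩ := Fr.lift (zeroP k k) hone
  obtain ⟨S, hS, hSi, hSj⟩ := Fr.lift (opP (Fr.str k C)) (Fr.inv k C).symm
  have hΔi' : ∀ c, Δ (Fr.i k C c) = TensorProduct.map (Fr.i k C) (Fr.i k C) (Coalgebra.comul c) :=
    fun c => LinearMap.congr_fun hΔi c
  have hεi' : ∀ c, ε (Fr.i k C c) = Coalgebra.counit c := fun c => LinearMap.congr_fun hεi c
  have hSi' : ∀ c, S (Fr.i k C c) = Fr.j k C c := fun c => LinearMap.congr_fun hSi c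
  have hSj' : ∀ c, S (Fr.j k C c) = Fr.i k C c := fun c => LinearMap.congr_fun hSj c
  have hid := poisson_id (Fr.str k C)
  -- coassociativity
  have e1 : (Algebra.TensorProduct.map Δ (AlgHom.id k _)).comp Δ =
      (Algebra.TensorProduct.assoc k k k (Fr k C) (Fr k C) (Fr k C)).symm.toAlgHom.comp
        ((Algebra.TensorProduct.map (AlgHom.id k _) Δ).comp Δ) := by
    refine Fr.poisson_ext (tensorP (tensorP (Fr.str k C) (Fr.str k C)) (Fr.str k C))
      (poisson_comp (poisson_map hΔ hid) hΔ)
      (poisson_comp (poisson_assoc_symm _ _ _) (poisson_comp (poisson_map hid hΔ) hΔ)) ?_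
    ext c
    have l1 : ∀ t : C ⊗[k] C, Algebra.TensorProduct.map Δ (AlgHom.id k _)
        (TensorProduct.map (Fr.i k C) (Fr.i k C) t) =
        TensorProduct.map (TensorProduct.map (Fr.i k C) (Fr.i k C)) (Fr.i k C)
          (Coalgebra.comul.rTensor C t) := by
      intro t
      induction t using TensorProduct.induction_on with
      | zero => simp
      | add x y hx hy => simp only [map_add, hx, hy]
      | tmul a b => simp [hΔi']
    have l2 : ∀ t : C ⊗[k] C, Algebra.TensorProduct.map (AlgHom.id k _) Δ
        (TensorProduct.map (Fr.i k C) (Fr.i k C) t) =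
        TensorProduct.map (Fr.i k C) (TensorProduct.map (Fr.i k C) (Fr.i k C))
          (Coalgebra.comul.lTensor C t) := by
      intro t
      induction t using TensorProduct.induction_on with
      | zero => simp
      | add x y hx hy => simp only [map_add, hx, hy]
      | tmul a b => simp [hΔi']
    have l3 : ∀ t : C ⊗[k] (C ⊗[k] C),
        (Algebra.TensorProduct.assoc k k k (Fr k C) (Fr k C) (Fr k C)).symm
          (TensorProduct.map (Fr.i k C) (TensorProduct.map (Fr.i k C) (Fr.i k C)) t) =
        TensorProduct.map (TensorProduct.map (Fr.i k C) (Fr.i k C)) (Fr.i k C)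
          ((TensorProduct.assoc k C C C).symm t) := by
      intro t
      induction t using TensorProduct.induction_on with
      | zero => simp
      | add x y hx hy => simp only [map_add, hx, hy]
      | tmul a b =>
        induction b using TensorProduct.induction_on with
        | zero => simp
        | add x y hx hy => simp only [map_add, TensorProduct.tmul_add, hx, hy]
        | tmul b d => simp
    change Algebra.TensorProduct.map Δ (AlgHom.id k _) (Δ (Fr.i k C c)) =
      (Algebra.TensorProduct.assoc k k k (Fr k C) (Fr k C) (Fr k C)).symm
        (Algebra.TensorProduct.map (AlgHom.id k _) Δ (Δ (Fr.i k C c)))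
    rw [hΔi', l1, l2, l3, Coalgebra.coassoc_symm_apply]
  have e2 : (Algebra.TensorProduct.lid k (Fr k C)).toAlgHom.comp
      ((Algebra.TensorProduct.map ε (AlgHom.id k _)).comp Δ) = AlgHom.id k _ := by
    refine Fr.poisson_ext (Fr.str k C)
      (poisson_comp (poisson_lid _) (poisson_comp (poisson_map hε hid) hΔ)) hid ?_
    ext c
    have l1 : ∀ t : C ⊗[k] C, Algebra.TensorProduct.lid k (Fr k C)
        (Algebra.TensorProduct.map ε (AlgHom.id k _) (TensorProduct.map (Fr.i k C) (Fr.i k C) t)) =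
        Fr.i k C (TensorProduct.lid k C (Coalgebra.counit.rTensor C t)) := by
      intro t
      induction t using TensorProduct.induction_on with
      | zero => simp
      | add x y hx hy => simp only [map_add, hx, hy]
      | tmul a b => simp [hεi']
    change Algebra.TensorProduct.lid k (Fr k C)
        (Algebra.TensorProduct.map ε (AlgHom.id k _) (Δ (Fr.i k C c))) = Fr.i k C c
    rw [hΔi', l1]
    simp
  have e3 : (Algebra.TensorProduct.rid k k (Fr k C)).toAlgHom.comp
      ((Algebra.TensorProduct.map (AlgHom.id k _) ε).comp Δ) = AlgHom.id k _ := by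
    refine Fr.poisson_ext (Fr.str k C)
      (poisson_comp (poisson_rid _) (poisson_comp (poisson_map hid hε) hΔ)) hid ?_
    ext c
    have l1 : ∀ t : C ⊗[k] C, Algebra.TensorProduct.rid k k (Fr k C)
        (Algebra.TensorProduct.map (AlgHom.id k _) ε (TensorProduct.map (Fr.i k C) (Fr.i k C) t)) =
        Fr.i k C (TensorProduct.rid k C (Coalgebra.counit.lTensor C t)) := by
      intro t
      induction t using TensorProduct.induction_on with
      | zero => simp
      | add x y hx hy => simp only [map_add, hx, hy]
      | tmul a b => simp [hεi']
    change Algebra.TensorProduct.rid k k (Fr k C)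
        (Algebra.TensorProduct.map (AlgHom.id k _) ε (Δ (Fr.i k C c))) = Fr.i k C c
    rw [hΔi', l1]
    simp
  -- antipode
  have hSS : S.comp S = AlgHom.id k _ := by
    refine Fr.poisson_ext (Fr.str k C) ?_ hid ?_
    · intro a b
      have h1 := hS a b
      have h2 := hS (S a) (S b)
      simp only [opP, LinearMap.neg_apply] at h1 h2
      rw [AlgHom.comp_apply, h1, map_neg, h2, neg_neg]; rfl
    · ext c
      change S (S (Fr.i k C c)) = Fr.i k C c
      rw [hSi', hSj']
  have e4 : (Algebra.TensorProduct.productMap S (AlgHom.id k _)).comp Δ =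
      (Algebra.ofId k (Fr k C)).comp ε := by
    refine Fr.hom_ext _ _ ?_ ?_
    · ext c
      have l1 : ∀ t : C ⊗[k] C, Algebra.TensorProduct.productMap S (AlgHom.id k _)
          (TensorProduct.map (Fr.i k C) (Fr.i k C) t) =
          LinearMap.mul' k _ (TensorProduct.map (Fr.j k C) (Fr.i k C) t) := by
        intro t
        induction t using TensorProduct.induction_on with
        | zero => simp
        | add x y hx hy => simp only [map_add, hx, hy]
        | tmul a b => simp [hSi']
      change Algebra.TensorProduct.productMap S (AlgHom.id k _) (Δ (Fr.i k C c)) =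
        algebraMap k _ (ε (Fr.i k C c))
      rw [hΔi', l1, hεi', ((convInv_iff _ _).1 (Fr.inv k C)).2 c]
    · intro a b ha hb
      change Algebra.TensorProduct.productMap S (AlgHom.id k _) (Δ a) =
        algebraMap k _ (ε a) at ha
      change Algebra.TensorProduct.productMap S (AlgHom.id k _) (Δ b) =
        algebraMap k _ (ε b) at hb
      change Algebra.TensorProduct.productMap S (AlgHom.id k _) (Δ ((Fr.str k C).br a b)) =
        algebraMap k _ (ε ((Fr.str k C).br a b))
      have hz : ∀ r : k, (Fr.str k C).br (algebraMap k _ r) = 0 := fun r =>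
        LinearMap.ext fun x => alg_br _ x r
      rw [hΔ, hε]
      change Algebra.TensorProduct.productMap S (AlgHom.id k _)
        (tbr (Fr.str k C) (Fr.str k C) (Δ a) (Δ b)) = algebraMap k _ 0
      rw [antipode_key _ S hS, ha, hb, hz, hz]
      simp
  have e4' : ∀ b, Algebra.TensorProduct.productMap S (AlgHom.id k _) (Δ b) =
      algebraMap k _ (ε b) := fun b => AlgHom.congr_fun e4 b
  have e5 : ∀ t, LinearMap.mul' k (Fr k C) (TensorProduct.map S.toLinearMap LinearMap.id t) =
      Algebra.TensorProduct.productMap S (AlgHom.id k _) t := by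
    intro t
    induction t using TensorProduct.induction_on with
    | zero => simp
    | add x y hx hy => simp only [map_add, hx, hy]
    | tmul a b => simp
  have e6 : ∀ t, LinearMap.mul' k (Fr k C) (TensorProduct.map LinearMap.id S.toLinearMap t) =
      S (Algebra.TensorProduct.productMap S (AlgHom.id k _) t) := by
    intro t
    induction t using TensorProduct.induction_on with
    | zero => simp
    | add x y hx hy => simp only [map_add, hx, hy]
    | tmul a b =>
      have := AlgHom.congr_fun hSS a
      simp at this
      simp [this]
  refine ⟨{ comul := Δ, counit := ε
            coassoc := fun b => AlgHom.congr_fun e1 b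
            counit_comul := fun b => AlgHom.congr_fun e2 b
            comul_counit := fun b => AlgHom.congr_fun e3 b
            antipode := S.toLinearMap
            antipode_comul := fun b => by rw [e5, e4']
            comul_antipode := fun b => by rw [e6, e4', AlgHom.commutes] }, ?_, hΔi, hεi⟩
  exact ⟨tensorP _ _, tensorP_is _ _, hΔ⟩

end FPH

/-- the forgetful functor from Poisson Hopf algebras to coalgebras has
a left adjoint, i.e. there is a free Poisson Hopf algebra on every coalgebra. -/
theorem free_poisson_hopf (k : Type u) [Field k] (C : Type u)
    [AddCommGroup C] [Module k C] (DC : CoalgData k C) :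
    ∃ (H : PoissonHopfBundle.{u, u} k) (ι : C →ₗ[k] H.carrier),
      IsCoalgHom DC H.hopf.toBialgData.toCoalgData ι ∧
      ∀ (K : PoissonHopfBundle.{u, u} k) (f : C →ₗ[k] K.carrier),
        IsCoalgHom DC K.hopf.toBialgData.toCoalgData f →
        ∃! g : H.carrier →ₐ[k] K.carrier,
          IsPoissonBialgHom H.str K.str H.hopf.toBialgData K.hopf.toBialgData g ∧
          ∀ c : C, g (ι c) = f c := by
  letI : Coalgebra k C := FPH.coalg DC
  obtain ⟨H, hH, hΔ, hε⟩ := FPH.exists_hopf (k := k) (C := C)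
  have hΔ' : ∀ c, H.comul (FPH.Fr.i k C c) =
      TensorProduct.map (FPH.Fr.i k C) (FPH.Fr.i k C) (DC.comul c) :=
    fun c => LinearMap.congr_fun hΔ c
  have hε' : ∀ c, H.counit (FPH.Fr.i k C c) = DC.counit c := fun c => LinearMap.congr_fun hε c
  refine ⟨{ carrier := FPH.Fr k C, str := FPH.Fr.str k C, hopf := H, compat := hH },
    FPH.Fr.i k C, ⟨hΔ', hε'⟩, ?_⟩
  rintro K f ⟨hf1, hf2⟩
  replace hf1 : ∀ c, K.hopf.comul (f c) = TensorProduct.map f f (DC.comul c) := hf1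
  replace hf2 : ∀ c, K.hopf.counit (f c) = DC.counit c := hf2
  have hinv : FPH.ConvInv f (K.hopf.antipode ∘ₗ f) := by
    rw [FPH.convInv_iff]
    constructor
    · intro c
      have h := K.hopf.comul_antipode (f c)
      rw [hf1, hf2, ← LinearMap.comp_apply (TensorProduct.map _ _), ← TensorProduct.map_comp] at h
      exact h
    · intro c
      have h := K.hopf.antipode_comul (f c)
      rw [hf1, hf2, ← LinearMap.comp_apply (TensorProduct.map _ _), ← TensorProduct.map_comp] at h
      exact h
  obtain ⟨φ, hφ, hφi, -⟩ := FPH.Fr.lift K.str hinv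
  have hφi' : ∀ c, φ (FPH.Fr.i k C c) = f c := fun c => LinearMap.congr_fun hφi c
  have hHp : IsPoissonHom (FPH.Fr.str k C) (FPH.tensorP (FPH.Fr.str k C) (FPH.Fr.str k C))
      H.comul := by
    obtain ⟨T, hT, hc⟩ := hH
    intro a b
    rw [hc, FPH.tensor_unique _ _ T hT]; rfl
  have hKp : IsPoissonHom K.str (FPH.tensorP K.str K.str) K.hopf.comul := by
    obtain ⟨T, hT, hc⟩ := K.compat
    intro a b
    rw [hc, FPH.tensor_unique _ _ T hT]; rfl
  have c1 : K.hopf.comul.comp φ = (Algebra.TensorProduct.map φ φ).comp H.comul := by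
    refine FPH.Fr.poisson_ext (FPH.tensorP K.str K.str) (FPH.poisson_comp hKp hφ)
      (FPH.poisson_comp (FPH.poisson_map hφ hφ) hHp) ?_
    ext c
    change K.hopf.comul (φ (FPH.Fr.i k C c)) =
      TensorProduct.map φ.toLinearMap φ.toLinearMap (H.comul (FPH.Fr.i k C c))
    rw [hφi', hf1, hΔ', ← hφi, TensorProduct.map_comp]
    rfl
  have c2 : K.hopf.counit.comp φ = H.counit := by
    refine FPH.Fr.poisson_ext (FPH.zeroP k k)
      (FPH.poisson_comp (FPH.counit_poisson _ _ K.compat) hφ) (FPH.counit_poisson _ _ hH) ?_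
    ext c
    change K.hopf.counit (φ (FPH.Fr.i k C c)) = H.counit (FPH.Fr.i k C c)
    rw [hφi', hf2, hε']
  refine ⟨φ, ⟨⟨hφ, fun a => AlgHom.congr_fun c1 a, fun a => AlgHom.congr_fun c2 a⟩, hφi'⟩, ?_⟩
  rintro ψ ⟨⟨hψ, -, -⟩, hψi⟩
  refine FPH.Fr.poisson_ext K.str hψ hφ ?_
  ext c
  exact (hψi c).trans (hφi' c).symm
end

section
/- In the construction of the free Poisson Hopf algebra on a Poisson bialgebra B, the Poisson ideal 𝓘 of C = ∐_{n∈ℕ} B_n (coproduct in Poisson bialgebras, B_n = B for n even and B^{op,cop} for n odd) generated by the convolution relations {(S' * id − u∘ε)(q_n(x)), (id * S' − u∘ε)(q_n(x)) : x ∈ B_n, n ∈ ℕ} is a coideal: Δ_C(𝓘) ⊆ C ⊗ 𝓘 + 𝓘 ⊗ C. -/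
open TensorProduct

universe u v w x

section helpers

variable {k : Type u} {C : Type v} [CommRing k] [CommRing C] [Algebra k C]

theorem map_comp_apply' {M N P M' N' P' : Type*} [AddCommGroup M] [AddCommGroup N] [AddCommGroup P]
    [AddCommGroup M'] [AddCommGroup N'] [AddCommGroup P'] [Module k M] [Module k N] [Module k P]
    [Module k M'] [Module k N'] [Module k P'] (f : N →ₗ[k] P) (f' : N' →ₗ[k] P')
    (g : M →ₗ[k] N) (g' : M' →ₗ[k] N') (t : M ⊗[k] M') :
    TensorProduct.map f f' (TensorProduct.map g g' t) = TensorProduct.map (f ∘ₗ g) (f' ∘ₗ g') t := by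
  rw [TensorProduct.map_comp]; rfl

/-- left convolution `S * id`. -/
def phiL (D : BialgData k C) (S : C →ₐ[k] C) : C →ₗ[k] C :=
  LinearMap.mul' k C ∘ₗ TensorProduct.map S.toLinearMap LinearMap.id ∘ₗ D.comul.toLinearMap

/-- right convolution `id * S`. -/
def phiR (D : BialgData k C) (S : C →ₐ[k] C) : C →ₗ[k] C :=
  LinearMap.mul' k C ∘ₗ TensorProduct.map LinearMap.id S.toLinearMap ∘ₗ D.comul.toLinearMap

/-- the map `u ∘ ε`. -/
def uEps (D : BialgData k C) : C →ₗ[k] C :=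
  (Algebra.linearMap k C) ∘ₗ D.counit.toLinearMap

/-- `a ⊗ (b ⊗ d) ↦ b ⊗ S a d`. -/
def mL (S : C →ₐ[k] C) : C ⊗[k] (C ⊗[k] C) →ₗ[k] C ⊗[k] C :=
  LinearMap.mul' k (C ⊗[k] C) ∘ₗ TensorProduct.map
    ((Algebra.TensorProduct.includeRight (R := k) (A := C) (B := C)).toLinearMap ∘ₗ S.toLinearMap)
    LinearMap.id

/-- `a ⊗ (b ⊗ d) ↦ a S d ⊗ b`. -/
def mR (S : C →ₐ[k] C) : C ⊗[k] (C ⊗[k] C) →ₗ[k] C ⊗[k] C :=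
  LinearMap.mul' k (C ⊗[k] C) ∘ₗ TensorProduct.map
    ((Algebra.TensorProduct.includeLeft (R := k) (S := k) (A := C) (B := C)).toLinearMap)
    ((TensorProduct.comm k C C).toLinearMap ∘ₗ TensorProduct.map LinearMap.id S.toLinearMap)

theorem mL_tmul (S : C →ₐ[k] C) (a b d : C) :
    mL (k := k) S (a ⊗ₜ (b ⊗ₜ d)) = b ⊗ₜ (S a * d) := by
  simp [mL]

theorem mR_tmul (S : C →ₐ[k] C) (a b d : C) :
    mR (k := k) S (a ⊗ₜ (b ⊗ₜ d)) = (a * S d) ⊗ₜ b := by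
  simp [mR]

/-- iterated comultiplication -/
def comul2 (D : BialgData k C) (c : C) : C ⊗[k] (C ⊗[k] C) :=
  TensorProduct.map LinearMap.id D.comul.toLinearMap (D.comul c)

theorem coassoc_lin (D : BialgData k C) :
    TensorProduct.map D.comul.toLinearMap LinearMap.id ∘ₗ D.comul.toLinearMap =
    (TensorProduct.assoc k C C C).symm.toLinearMap ∘ₗ
      TensorProduct.map LinearMap.id D.comul.toLinearMap ∘ₗ D.comul.toLinearMap := by
  ext c; exact D.coassoc c

theorem comul_comul (D : BialgData k C) (c : C) :
    TensorProduct.map D.comul.toLinearMap D.comul.toLinearMap (D.comul c) =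
    TensorProduct.map LinearMap.id D.comul.toLinearMap
      ((TensorProduct.assoc k C C C).symm (comul2 D c)) := by
  rw [comul2, ← D.coassoc, map_comp_apply']; rfl

theorem comul2_mid (D : BialgData k C) (c : C) :
    TensorProduct.map LinearMap.id (TensorProduct.map D.comul.toLinearMap LinearMap.id)
      (comul2 D c) =
    TensorProduct.map LinearMap.id ((TensorProduct.assoc k C C C).symm.toLinearMap ∘ₗ
      TensorProduct.map LinearMap.id D.comul.toLinearMap) (comul2 D c) := by
  rw [comul2, map_comp_apply', map_comp_apply', coassoc_lin]; rfl

theorem comul_phiL (D : BialgData k C) (S : C →ₐ[k] C)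
    (hS : ∀ a : C, D.comul (S a) =
      TensorProduct.comm k C C (TensorProduct.map S.toLinearMap S.toLinearMap (D.comul a)))
    (c : C) :
    D.comul (phiL D S c) =
      mL S (TensorProduct.map LinearMap.id (TensorProduct.map (phiL D S) LinearMap.id)
        (comul2 D c)) := by
  have h1 : ∀ t : C ⊗[k] C, D.comul (LinearMap.mul' k C (TensorProduct.map S.toLinearMap
      LinearMap.id t)) = LinearMap.mul' k (C ⊗[k] C) (TensorProduct.map
        ((TensorProduct.comm k C C).toLinearMap ∘ₗ TensorProduct.map S.toLinearMap S.toLinearMap)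
        LinearMap.id (TensorProduct.map D.comul.toLinearMap D.comul.toLinearMap t)) := by
    intro t
    induction t with
    | zero => simp
    | add x y hx hy => simp only [map_add, hx, hy]
    | tmul a b => simp [hS]
  have h2 : TensorProduct.map LinearMap.id (TensorProduct.map (phiL D S) LinearMap.id)
        (comul2 D c) = TensorProduct.map LinearMap.id (TensorProduct.map
          (LinearMap.mul' k C ∘ₗ TensorProduct.map S.toLinearMap LinearMap.id) LinearMap.id)
        (TensorProduct.map LinearMap.id (TensorProduct.map D.comul.toLinearMap LinearMap.id)
      (comul2 D c)) := by
    rw [map_comp_apply', ← TensorProduct.map_comp]; rfl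
  rw [h2, comul2_mid]
  refine (h1 _).trans ?_
  rw [AlgHom.toLinearMap_apply, comul_comul]
  generalize comul2 D c = t
  induction t with
  | zero => simp
  | add x y hx hy => simp only [map_add, hx, hy]
  | tmul a t =>
    induction t with
    | zero => simp
    | add x y hx hy => simp only [TensorProduct.tmul_add, map_add, hx, hy]
    | tmul b d =>
      simp only [TensorProduct.assoc_symm_tmul, TensorProduct.map_tmul, LinearMap.comp_apply,
        LinearMap.id_apply, AlgHom.toLinearMap_apply, LinearMap.mul'_apply,
        LinearEquiv.coe_coe, TensorProduct.comm_tmul]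
      generalize D.comul d = z
      induction z with
      | zero => simp
      | add x y hx hy => simp only [TensorProduct.tmul_add, mul_add, map_add, hx, hy]
      | tmul e f => simp [mL_tmul]

theorem comul_phiR (D : BialgData k C) (S : C →ₐ[k] C)
    (hS : ∀ a : C, D.comul (S a) =
      TensorProduct.comm k C C (TensorProduct.map S.toLinearMap S.toLinearMap (D.comul a)))
    (c : C) :
    D.comul (phiR D S c) =
      mR S (TensorProduct.map LinearMap.id (TensorProduct.map (phiR D S) LinearMap.id)
        (comul2 D c)) := by
  have h1 : ∀ t : C ⊗[k] C, D.comul (LinearMap.mul' k C (TensorProduct.map LinearMap.id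
      S.toLinearMap t)) = LinearMap.mul' k (C ⊗[k] C) (TensorProduct.map LinearMap.id
        ((TensorProduct.comm k C C).toLinearMap ∘ₗ TensorProduct.map S.toLinearMap S.toLinearMap)
        (TensorProduct.map D.comul.toLinearMap D.comul.toLinearMap t)) := by
    intro t
    induction t with
    | zero => simp
    | add x y hx hy => simp only [map_add, hx, hy]
    | tmul a b => simp [hS]
  have h2 : TensorProduct.map LinearMap.id (TensorProduct.map (phiR D S) LinearMap.id)
        (comul2 D c) = TensorProduct.map LinearMap.id (TensorProduct.map
          (LinearMap.mul' k C ∘ₗ TensorProduct.map LinearMap.id S.toLinearMap) LinearMap.id)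
        (TensorProduct.map LinearMap.id (TensorProduct.map D.comul.toLinearMap LinearMap.id)
      (comul2 D c)) := by
    rw [map_comp_apply', ← TensorProduct.map_comp]; rfl
  rw [h2, comul2_mid]
  refine (h1 _).trans ?_
  rw [AlgHom.toLinearMap_apply, comul_comul]
  generalize comul2 D c = t
  induction t with
  | zero => simp
  | add x y hx hy => simp only [map_add, hx, hy]
  | tmul a t =>
    induction t with
    | zero => simp
    | add x y hx hy => simp only [TensorProduct.tmul_add, map_add, hx, hy]
    | tmul b d =>
      simp only [TensorProduct.assoc_symm_tmul, TensorProduct.map_tmul, LinearMap.comp_apply,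
        LinearMap.id_apply, AlgHom.toLinearMap_apply, LinearMap.mul'_apply,
        LinearEquiv.coe_coe]
      generalize D.comul d = z
      induction z with
      | zero => simp
      | add x y hx hy => simp only [TensorProduct.tmul_add, mul_add, map_add, hx, hy]
      | tmul e f => simp [mR_tmul]

theorem eps_mid (D : BialgData k C) (c : C) :
    TensorProduct.map LinearMap.id (TensorProduct.map (uEps D) LinearMap.id) (comul2 D c) =
    TensorProduct.map LinearMap.id (TensorProduct.mk k C C 1) (D.comul c) := by
  have h : TensorProduct.map (uEps D) LinearMap.id ∘ₗ D.comul.toLinearMap =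
      TensorProduct.mk k C C 1 := by
    ext d
    have h3 : ∀ t : C ⊗[k] C, TensorProduct.map (uEps D) LinearMap.id t =
        (1 : C) ⊗ₜ[k] (TensorProduct.lid k C (TensorProduct.map D.counit.toLinearMap
          LinearMap.id t)) := by
      intro t
      induction t with
      | zero => simp
      | add x y hx hy => simp only [map_add, hx, hy, TensorProduct.tmul_add]
      | tmul a b =>
        simp [uEps, Algebra.algebraMap_eq_smul_one, TensorProduct.smul_tmul]
    simp only [LinearMap.comp_apply, AlgHom.toLinearMap_apply, h3, D.counit_comul,
      TensorProduct.mk_apply]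
  rw [comul2, map_comp_apply', h]; rfl

theorem mL_eps (D : BialgData k C) (S : C →ₐ[k] C) (c : C) :
    mL S (TensorProduct.map LinearMap.id (TensorProduct.map (uEps D) LinearMap.id) (comul2 D c)) =
      (1 : C) ⊗ₜ[k] phiL D S c := by
  rw [eps_mid]
  simp only [phiL, LinearMap.comp_apply, AlgHom.toLinearMap_apply]
  generalize D.comul c = t
  induction t with
  | zero => simp
  | add x y hx hy => simp only [map_add, hx, hy, TensorProduct.tmul_add]
  | tmul a b => simp [mL_tmul]

theorem mR_eps (D : BialgData k C) (S : C →ₐ[k] C) (c : C) :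
    mR S (TensorProduct.map LinearMap.id (TensorProduct.map (uEps D) LinearMap.id) (comul2 D c)) =
      phiR D S c ⊗ₜ[k] (1 : C) := by
  rw [eps_mid]
  simp only [phiR, LinearMap.comp_apply, AlgHom.toLinearMap_apply]
  generalize D.comul c = t
  induction t with
  | zero => simp
  | add x y hx hy => simp only [map_add, hx, hy, TensorProduct.add_tmul]
  | tmul a b => simp [mR_tmul]

theorem comul_uEps (D : BialgData k C) (c : C) :
    D.comul (uEps D c) = (1 : C) ⊗ₜ[k] uEps D c := by
  simp [uEps, Algebra.algebraMap_eq_smul_one, Algebra.TensorProduct.one_def]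

theorem comul_uEps' (D : BialgData k C) (c : C) :
    D.comul (uEps D c) = uEps D c ⊗ₜ[k] (1 : C) := by
  simp [uEps, Algebra.algebraMap_eq_smul_one, Algebra.TensorProduct.one_def,
    TensorProduct.smul_tmul']

theorem map_mid_sub (f g : C →ₗ[k] C) (t : C ⊗[k] (C ⊗[k] C)) :
    TensorProduct.map LinearMap.id (TensorProduct.map (f - g) LinearMap.id) t =
    TensorProduct.map LinearMap.id (TensorProduct.map f LinearMap.id) t -
    TensorProduct.map LinearMap.id (TensorProduct.map g LinearMap.id) t := by
  induction t with
  | zero => simp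
  | add x y hx hy => simp only [map_add, hx, hy]; abel
  | tmul a t =>
    induction t with
    | zero => simp
    | add x y hx hy =>
      simp only [TensorProduct.tmul_add, map_add, hx, hy]; abel
    | tmul b d =>
      simp [TensorProduct.sub_tmul, TensorProduct.tmul_sub]

theorem comul_relL (D : BialgData k C) (S : C →ₐ[k] C)
    (hS : ∀ a : C, D.comul (S a) =
      TensorProduct.comm k C C (TensorProduct.map S.toLinearMap S.toLinearMap (D.comul a)))
    (c : C) :
    D.comul ((phiL D S - uEps D) c) =
      mL S (TensorProduct.map LinearMap.id (TensorProduct.map (phiL D S - uEps D) LinearMap.id)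
        (comul2 D c)) + (1 : C) ⊗ₜ[k] (phiL D S - uEps D) c := by
  rw [map_mid_sub, map_sub, mL_eps, ← comul_phiL D S hS, LinearMap.sub_apply, map_sub,
    comul_uEps, TensorProduct.tmul_sub]
  abel

theorem comul_relR (D : BialgData k C) (S : C →ₐ[k] C)
    (hS : ∀ a : C, D.comul (S a) =
      TensorProduct.comm k C C (TensorProduct.map S.toLinearMap S.toLinearMap (D.comul a)))
    (c : C) :
    D.comul ((phiR D S - uEps D) c) =
      mR S (TensorProduct.map LinearMap.id (TensorProduct.map (phiR D S - uEps D) LinearMap.id)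
        (comul2 D c)) + (phiR D S - uEps D) c ⊗ₜ[k] (1 : C) := by
  rw [map_mid_sub, map_sub, mR_eps, ← comul_phiR D S hS, LinearMap.sub_apply, map_sub,
    comul_uEps', TensorProduct.sub_tmul]
  abel

theorem tmul_mem_sweedler_right (I : Submodule k C) (a b : C) (hb : b ∈ I) :
    a ⊗ₜ[k] b ∈ sweedlerSpan I :=
  Submodule.mem_sup_left ⟨a ⊗ₜ ⟨b, hb⟩, by simp⟩

theorem tmul_mem_sweedler_left (I : Submodule k C) (a b : C) (ha : a ∈ I) :
    a ⊗ₜ[k] b ∈ sweedlerSpan I :=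
  Submodule.mem_sup_right ⟨⟨a, ha⟩ ⊗ₜ b, by simp⟩

theorem sweedler_le (I : Submodule k C) (W : Submodule k (C ⊗[k] C))
    (h1 : ∀ a b : C, b ∈ I → a ⊗ₜ[k] b ∈ W) (h2 : ∀ a b : C, a ∈ I → a ⊗ₜ[k] b ∈ W) :
    sweedlerSpan I ≤ W := by
  refine sup_le ?_ ?_
  · rintro _ ⟨t, rfl⟩
    induction t with
    | zero => simp
    | add x y hx hy => rw [map_add]; exact add_mem hx hy
    | tmul a b => exact h1 _ _ b.2
  · rintro _ ⟨t, rfl⟩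
    induction t with
    | zero => simp
    | add x y hx hy => rw [map_add]; exact add_mem hx hy
    | tmul a b => exact h2 _ _ a.2

theorem sweedler_mul (I : Ideal C) (z w : C ⊗[k] C)
    (hw : w ∈ sweedlerSpan (Submodule.restrictScalars k I)) :
    z * w ∈ sweedlerSpan (Submodule.restrictScalars k I) := by
  induction z with
  | zero => simp
  | add x y hx hy => rw [add_mul]; exact add_mem hx hy
  | tmul p q =>
    have : sweedlerSpan (Submodule.restrictScalars k I) ≤
        (sweedlerSpan (Submodule.restrictScalars k I)).comap
          (LinearMap.mulLeft k (p ⊗ₜ[k] q)) := by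
      apply sweedler_le
      · intro a b hb
        simpa using tmul_mem_sweedler_right (Submodule.restrictScalars k I) _ _
          (I.mul_mem_left q hb)
      · intro a b hb
        simpa using tmul_mem_sweedler_left (Submodule.restrictScalars k I) _ _
          (I.mul_mem_left p hb)
    exact this hw

theorem sweedler_br (P : PoissonStr k C) (T : PoissonStr k (C ⊗[k] C))
    (hT : IsTensorPoissonStr P P T) (I : Ideal C) (hI : IsPoissonIdeal P I) (z w : C ⊗[k] C)
    (hw : w ∈ sweedlerSpan (Submodule.restrictScalars k I)) :
    T.br z w ∈ sweedlerSpan (Submodule.restrictScalars k I) := by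
  induction z with
  | zero => simp
  | add x y hx hy => rw [map_add]; exact add_mem hx hy
  | tmul p q =>
    have : sweedlerSpan (Submodule.restrictScalars k I) ≤
        (sweedlerSpan (Submodule.restrictScalars k I)).comap (T.br (p ⊗ₜ[k] q)) := by
      apply sweedler_le
      · intro a b hb
        rw [Submodule.mem_comap, hT]
        exact add_mem (tmul_mem_sweedler_right _ _ _ (hI q b hb))
          (tmul_mem_sweedler_right _ _ _ (I.mul_mem_left q hb))
      · intro a b hb
        rw [Submodule.mem_comap, hT]
        exact add_mem (tmul_mem_sweedler_left _ _ _ (I.mul_mem_left p hb))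
          (tmul_mem_sweedler_left _ _ _ (hI p a hb))
    exact this hw

theorem poissonIdealGen_le (P : PoissonStr k C) (s : Set C) (J : Ideal C) (h1 : s ⊆ J)
    (h2 : IsPoissonIdeal P J) : poissonIdealGen P s ≤ J := sInf_le ⟨h1, h2⟩

theorem subset_poissonIdealGen (P : PoissonStr k C) (s : Set C) :
    s ⊆ poissonIdealGen P s := by
  intro y hy
  simp only [poissonIdealGen, SetLike.mem_coe, Submodule.mem_sInf]
  exact fun J hJ => hJ.1 hy

theorem isPoissonIdeal_gen (P : PoissonStr k C) (s : Set C) :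
    IsPoissonIdeal P (poissonIdealGen P s) := by
  intro p a ha
  simp only [poissonIdealGen, Submodule.mem_sInf] at ha ⊢
  exact fun J hJ => hJ.2 p a (ha J hJ)

theorem comul2_mem {B : Type w} [CommRing B] [Algebra k B] (D : BialgData k C) (f : B →ₐ[k] C)
    (h : ∀ x : B, ∃ t : B ⊗[k] B,
      D.comul (f x) = TensorProduct.map f.toLinearMap f.toLinearMap t) (x : B) :
    ∃ t : B ⊗[k] (B ⊗[k] B), comul2 D (f x) =
      TensorProduct.map f.toLinearMap (TensorProduct.map f.toLinearMap f.toLinearMap) t := by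
  obtain ⟨t, ht⟩ := h x
  rw [comul2, ht]
  clear ht
  induction t with
  | zero => exact ⟨0, by simp⟩
  | add x y hx hy =>
    obtain ⟨a, ha⟩ := hx
    obtain ⟨b, hb⟩ := hy
    exact ⟨a + b, by simp only [map_add, ha, hb]⟩
  | tmul a b =>
    obtain ⟨s, hs⟩ := h b
    exact ⟨a ⊗ₜ s, by simp [hs]⟩

end helpers

/-- in the construction of the free Poisson Hopf algebra on a Poisson
bialgebra `B`, let `C = ∐_{n} B_n` be the coproduct in Poisson bialgebras of
`B_n = B` (`n` even) and `B_n = B^{op,cop}` (`n` odd) with injections `q n`, and let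
`S' : C → C^{op,cop}` be the shift morphism with `S' ∘ q n = q (n+1)`. Then the
Poisson ideal `𝓘` generated by the convolution relations
`(S' * id − u ∘ ε)(q n x)` and `(id * S' − u ∘ ε)(q n x)` is a coideal:
`Δ_C(𝓘) ⊆ C ⊗ 𝓘 + 𝓘 ⊗ C`. -/
theorem free_hopf_ideal_coideal (k B C : Type u) [Field k]
    [CommRing B] [Algebra k B] [CommRing C] [Algebra k C]
    (PB : PoissonStr k B) (DB : BialgData k B) (hB : IsPoissonBialg PB DB)
    (PC : PoissonStr k C) (DC : BialgData k C) (hC : IsPoissonBialg PC DC)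
    (q : ℕ → (B →ₐ[k] C))
    (heven : ∀ n, Even n → IsPoissonBialgHom PB PC DB DC (q n))
    (hodd : ∀ n, ¬ Even n → IsOpPoissonBialgHom PB PC DB DC (q n))
    (hcoprod : ∀ (R : PoissonBialgBundle.{u, u} k) (u' : ℕ → (B →ₐ[k] R.carrier)),
      (∀ n, Even n → IsPoissonBialgHom PB R.str DB R.bi (u' n)) →
      (∀ n, ¬ Even n → IsOpPoissonBialgHom PB R.str DB R.bi (u' n)) →
      ∃! v : C →ₐ[k] R.carrier,
        IsPoissonBialgHom PC R.str DC R.bi v ∧ ∀ n x, v (q n x) = u' n x)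
    (S' : C →ₐ[k] C)
    (hS'q : ∀ (n : ℕ) (x : B), S' (q n x) = q (n + 1) x)
    (hS' : IsOpPoissonBialgHom PC PC DC DC S')
    (I : Ideal C)
    (hIdef : I = poissonIdealGen PC {y : C | ∃ (n : ℕ) (x : B),
      y = LinearMap.mul' k C
            (TensorProduct.map S'.toLinearMap LinearMap.id (DC.comul (q n x))) -
          algebraMap k C (DC.counit (q n x)) ∨
      y = LinearMap.mul' k C
            (TensorProduct.map LinearMap.id S'.toLinearMap (DC.comul (q n x))) -
          algebraMap k C (DC.counit (q n x))}) :
    ∀ y ∈ I, DC.comul y ∈ sweedlerSpan (Submodule.restrictScalars k I) := by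
  have hmem : ∀ n (x : B), ∃ t : B ⊗[k] B,
      DC.comul (q n x) = TensorProduct.map (q n).toLinearMap (q n).toLinearMap t := by
    intro n x
    by_cases hn : Even n
    · exact ⟨_, (heven n hn).2.1 x⟩
    · refine ⟨TensorProduct.comm k B B (DB.comul x), ?_⟩
      rw [(hodd n hn).2.1 x, TensorProduct.map_comm]
  have hIP : IsPoissonIdeal PC I := hIdef ▸ isPoissonIdeal_gen _ _
  have hL : ∀ n x, (phiL DC S' - uEps DC) (q n x) ∈ I := by
    intro n x
    rw [hIdef]
    exact subset_poissonIdealGen _ _ ⟨n, x, Or.inl rfl⟩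
  have hR : ∀ n x, (phiR DC S' - uEps DC) (q n x) ∈ I := by
    intro n x
    rw [hIdef]
    exact subset_poissonIdealGen _ _ ⟨n, x, Or.inr rfl⟩
  obtain ⟨T, hT, hTD⟩ := hC
  let J : Ideal C :=
    { carrier := {y | DC.comul y ∈ sweedlerSpan (Submodule.restrictScalars k I)}
      zero_mem' := by simp
      add_mem' := by
        intro a b ha hb
        simp only [Set.mem_ofPred_eq, map_add] at *
        exact add_mem ha hb
      smul_mem' := by
        intro c a ha
        simp only [Set.mem_ofPred_eq, smul_eq_mul, map_mul] at *
        exact sweedler_mul I _ _ ha }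
  have hJP : IsPoissonIdeal PC J := by
    intro p a ha
    change DC.comul _ ∈ sweedlerSpan (Submodule.restrictScalars k I)
    rw [hTD]
    exact sweedler_br PC T hT I hIP _ _ ha
  have key : I ≤ J := by
    conv_lhs => rw [hIdef]
    refine poissonIdealGen_le _ _ _ ?_ hJP
    rintro y ⟨n, x, rfl | rfl⟩
    · change DC.comul ((phiL DC S' - uEps DC) (q n x)) ∈ sweedlerSpan (Submodule.restrictScalars k I)
      rw [comul_relL DC S' hS'.2.1]
      refine add_mem ?_ (tmul_mem_sweedler_right _ _ _ (hL n x))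
      obtain ⟨t, ht⟩ := comul2_mem DC (q n) (hmem n) x
      rw [ht]
      clear ht
      induction t with
      | zero => simp
      | add x y hx hy => simp only [map_add]; exact add_mem hx hy
      | tmul a t =>
        induction t with
        | zero => simp
        | add x y hx hy => simp only [TensorProduct.tmul_add, map_add]; exact add_mem hx hy
        | tmul b d =>
          simp only [TensorProduct.map_tmul, mL_tmul]
          exact tmul_mem_sweedler_left _ _ _ (hL n b)
    · change DC.comul ((phiR DC S' - uEps DC) (q n x)) ∈ sweedlerSpan (Submodule.restrictScalars k I)
      rw [comul_relR DC S' hS'.2.1]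
      refine add_mem ?_ (tmul_mem_sweedler_left _ _ _ (hR n x))
      obtain ⟨t, ht⟩ := comul2_mem DC (q n) (hmem n) x
      rw [ht]
      clear ht
      induction t with
      | zero => simp
      | add x y hx hy => simp only [map_add]; exact add_mem hx hy
      | tmul a t =>
        induction t with
        | zero => simp
        | add x y hx hy => simp only [TensorProduct.tmul_add, map_add]; exact add_mem hx hy
        | tmul b d =>
          simp only [TensorProduct.map_tmul, mR_tmul]
          exact tmul_mem_sweedler_right _ _ _ (hR n b)
  exact fun y hy => key hy
end

section
/- In the construction of the free Poisson Hopf algebra, the Poisson ideal 𝓘 generated by the convolution relations is stable under the map S': S'(𝓘) ⊆ 𝓘; consequently the quotient C/𝓘 carries a Poisson Hopf algebra structure with antipode induced by S'. -/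
open TensorProduct

universe u v w x

section helpers

variable {k : Type u} [CommRing k]

theorem PoissonStr.skew {A : Type v} [CommRing A] [Algebra k A] (P : PoissonStr k A) (a b : A) :
    P.br a b = - P.br b a := by
  have h := P.br_self (a + b)
  simp only [map_add, LinearMap.add_apply, P.br_self, zero_add, add_zero] at h
  exact eq_neg_of_add_eq_zero_right h

theorem PoissonStr.br_one {A : Type v} [CommRing A] [Algebra k A] (P : PoissonStr k A) (a : A) :
    P.br a 1 = 0 := by
  have h := P.leibniz a 1 1
  simpa using h

theorem PoissonStr.br_algebraMap {A : Type v} [CommRing A] [Algebra k A] (P : PoissonStr k A)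
    (a : A) (r : k) : P.br a (algebraMap k A r) = 0 := by
  rw [Algebra.algebraMap_eq_smul_one, map_smul, P.br_one, smul_zero]

theorem exists_push {A : Type v} {B : Type w} [CommRing A] [Algebra k A] [CommRing B] [Algebra k B]
    (PA : PoissonStr k A) (f : A →ₐ[k] B) (hf : Function.Surjective f)
    (hker : ∀ p a, f a = 0 → f (PA.br p a) = 0) :
    ∃ PB : PoissonStr k B, IsPoissonHom PA PB f := by
  have hw : ∀ a a' b b', f a = f a' → f b = f b' → f (PA.br a b) = f (PA.br a' b') := by
    intro a a' b b' h1 h2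
    have e1 : f (PA.br a (b - b')) = 0 := hker _ _ (by simp [h2])
    have e2 : f (PA.br b' (a - a')) = 0 := hker _ _ (by simp [h1])
    rw [map_sub, map_sub, sub_eq_zero] at e1 e2
    rw [e1, PA.skew a, PA.skew a', map_neg, map_neg, e2]
  let s := Function.surjInv hf
  have hs : ∀ x, f (s x) = x := Function.surjInv_eq hf
  let b : B →ₗ[k] B →ₗ[k] B := LinearMap.mk₂ k (fun x y => f (PA.br (s x) (s y)))
    (by
      intro x x' y
      rw [← map_add, ← LinearMap.add_apply, ← map_add]
      exact hw _ _ _ _ (by simp [hs]) rfl)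
    (by
      intro c x y
      rw [← map_smul, ← LinearMap.smul_apply, ← map_smul]
      exact hw _ _ _ _ (by simp [hs]) rfl)
    (by
      intro x y y'
      rw [← map_add, ← map_add]
      exact hw _ _ _ _ rfl (by simp [hs]))
    (by
      intro c x y
      rw [← map_smul, ← map_smul]
      exact hw _ _ _ _ rfl (by simp [hs]))
  have hb : ∀ x y, f (PA.br x y) = b (f x) (f y) := fun x y =>
    hw _ _ _ _ (hs _).symm (hs _).symm
  refine ⟨⟨b, ?_, ?_, ?_⟩, hb⟩
  · intro a
    obtain ⟨a, rfl⟩ := hf a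
    rw [← hb, PA.br_self, map_zero]
  · intro x y z
    obtain ⟨x, rfl⟩ := hf x
    obtain ⟨y, rfl⟩ := hf y
    obtain ⟨z, rfl⟩ := hf z
    simp only [← hb]
    rw [PA.jacobi, map_add]
  · intro x y z
    obtain ⟨x, rfl⟩ := hf x
    obtain ⟨y, rfl⟩ := hf y
    obtain ⟨z, rfl⟩ := hf z
    simp only [← hb, ← map_mul]
    rw [PA.leibniz, map_add]

theorem exists_pull {A : Type v} {B : Type w} [CommRing A] [Algebra k A] [CommRing B] [Algebra k B]
    (PB : PoissonStr k B) (f : A →ₐ[k] B) (hf : Function.Injective f)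
    (hr : ∀ a b, ∃ c, f c = PB.br (f a) (f b)) :
    ∃ PA : PoissonStr k A, IsPoissonHom PA PB f := by
  choose g hg using hr
  let b : A →ₗ[k] A →ₗ[k] A := LinearMap.mk₂ k g
    (by intros; apply hf; simp [hg]) (by intros; apply hf; simp [hg])
    (by intros; apply hf; simp [hg]) (by intros; apply hf; simp [hg])
  have hb : ∀ x y, f (b x y) = PB.br (f x) (f y) := hg
  refine ⟨⟨b, ?_, ?_, ?_⟩, hb⟩
  · intro a; apply hf; rw [hb, PB.br_self, map_zero]
  · intro x y z; apply hf; simp only [hb, map_add]; exact PB.jacobi _ _ _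
  · intro x y z; apply hf; simp only [hb, map_add, map_mul]; exact PB.leibniz _ _ _

/-- `f ⊗ f` is Poisson when `f` is. -/
theorem map_poisson {A : Type v} {B : Type w} [CommRing A] [Algebra k A] [CommRing B] [Algebra k B]
    {PA : PoissonStr k A} {PB : PoissonStr k B} {TA : PoissonStr k (A ⊗[k] A)}
    {TB : PoissonStr k (B ⊗[k] B)} (hA : IsTensorPoissonStr PA PA TA)
    (hB : IsTensorPoissonStr PB PB TB) (f : A →ₐ[k] B) (hf : IsPoissonHom PA PB f) :
    IsPoissonHom TA TB (Algebra.TensorProduct.map f f) := by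
  intro x y
  induction x using TensorProduct.induction_on with
  | zero => simp
  | add x x' h h' => simp only [map_add, LinearMap.add_apply, h, h']
  | tmul p q =>
    induction y using TensorProduct.induction_on with
    | zero => simp
    | add x x' h h' => simp only [map_add, h, h']
    | tmul r s =>
      rw [hA, map_add]
      simp only [Algebra.TensorProduct.map_tmul, map_mul]
      rw [hB, hf, hf]

theorem exists_tensor_push {A : Type v} {B : Type w} [CommRing A] [Algebra k A]
    [CommRing B] [Algebra k B]
    {PA : PoissonStr k A} {PB : PoissonStr k B} {TA : PoissonStr k (A ⊗[k] A)}
    (hA : IsTensorPoissonStr PA PA TA) (f : A →ₐ[k] B) (hf : IsPoissonHom PA PB f)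
    (hsurj : Function.Surjective f) :
    ∃ TB : PoissonStr k (B ⊗[k] B), IsTensorPoissonStr PB PB TB := by
  set F := Algebra.TensorProduct.map f f with hF
  have hFs : Function.Surjective F := Algebra.TensorProduct.map_surjective f f hsurj hsurj
  let J : Ideal (A ⊗[k] A) :=
    { carrier := {z | F z = 0 ∧ ∀ p, F (TA.br p z) = 0}
      zero_mem' := by simp
      add_mem' := by
        rintro a b ⟨h1, h2⟩ ⟨h3, h4⟩
        exact ⟨by simp [h1, h3], fun p => by simp [h2, h4]⟩
      smul_mem' := by
        rintro c a ⟨h1, h2⟩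
        exact ⟨by simp [h1], fun p => by simp [TA.leibniz, h1, h2]⟩ }
  have hJ : RingHom.ker F ≤ J := by
    rw [hF, Algebra.TensorProduct.map_ker f f hsurj hsurj, sup_le_iff, Ideal.map_le_iff_le_comap,
      Ideal.map_le_iff_le_comap]
    refine ⟨fun a ha => ⟨?_, fun p => ?_⟩, fun a ha => ⟨?_, fun p => ?_⟩⟩
    all_goals have ha : f a = 0 := ha
    · simp [F, ha]
    · induction p using TensorProduct.induction_on with
      | zero => simp
      | add x x' h h' => simp only [map_add, LinearMap.add_apply, h, h', add_zero]
      | tmul p q =>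
        have h0 := hf p a
        change F (TA.br (p ⊗ₜ q) (a ⊗ₜ 1)) = 0
        rw [hA, PA.br_one]
        simp [F, h0, ha]
    · simp [F, ha]
    · induction p using TensorProduct.induction_on with
      | zero => simp
      | add x x' h h' => simp only [map_add, LinearMap.add_apply, h, h', add_zero]
      | tmul p q =>
        have h0 := hf q a
        change F (TA.br (p ⊗ₜ q) (1 ⊗ₜ a)) = 0
        rw [hA, PA.br_one]
        simp [F, h0, ha]
  obtain ⟨TB, hTB⟩ := exists_push TA F hFs (fun p a ha => (hJ (x := a) ha).2 p)
  refine ⟨TB, ?_⟩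
  intro p r q s
  obtain ⟨p, rfl⟩ := hsurj p
  obtain ⟨q, rfl⟩ := hsurj q
  obtain ⟨r, rfl⟩ := hsurj r
  obtain ⟨s, rfl⟩ := hsurj s
  have h := hTB (p ⊗ₜ q) (r ⊗ₜ s)
  rw [hA] at h
  simp only [F, map_add, Algebra.TensorProduct.map_tmul, map_mul] at h
  rw [← h, hf, hf]

theorem counit_br {A : Type v} [CommRing A] [Algebra k A] {P : PoissonStr k A} {D : BialgData k A}
    (h : IsPoissonBialg P D) (a b : A) : D.counit (P.br a b) = 0 := by
  obtain ⟨T, hT, hc⟩ := h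
  let e := D.counit
  let E : A ⊗[k] A →ₐ[k] k := Algebra.TensorProduct.productMap e e
  have hl : ∀ c, e (TensorProduct.lid k A (TensorProduct.map e.toLinearMap LinearMap.id c)) = E c := by
    intro c
    induction c using TensorProduct.induction_on with
    | zero => simp
    | add x y h h' => simp only [map_add, h, h']
    | tmul x y => simp [E]
  have hE : ∀ c, E (D.comul c) = e c := fun c => by rw [← hl, D.counit_comul]
  have key : ∀ x y, E (T.br x y) =
      e (P.br (TensorProduct.lid k A (TensorProduct.map e.toLinearMap LinearMap.id x))
        (TensorProduct.lid k A (TensorProduct.map e.toLinearMap LinearMap.id y))) +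
      e (P.br (TensorProduct.rid k A (TensorProduct.map LinearMap.id e.toLinearMap x))
        (TensorProduct.rid k A (TensorProduct.map LinearMap.id e.toLinearMap y))) := by
    intro x y
    induction x using TensorProduct.induction_on with
    | zero => simp
    | add x x' h h' =>
      simp only [map_add, LinearMap.add_apply, h, h']; ring
    | tmul p q =>
      induction y using TensorProduct.induction_on with
      | zero => simp
      | add x x' h h' => 
        simp only [map_add, h, h']; ring
      | tmul r s =>
        rw [hT]
        simp [E]
        ring
  have h1 := key (D.comul a) (D.comul b)
  rw [← hc, hE, D.counit_comul, D.comul_counit, D.counit_comul, D.comul_counit] at h1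
  exact left_eq_add.mp h1

/-- Convolution of algebra maps into a commutative algebra. -/
noncomputable def cv {B : Type v} [CommRing B] [Algebra k B] (D : BialgData k B) {A : Type w}
    [CommRing A] [Algebra k A] (f g : B →ₐ[k] A) : B →ₐ[k] A :=
  (Algebra.TensorProduct.productMap f g).comp D.comul

/-- Convolution unit. -/
noncomputable def cv1 {B : Type v} [CommRing B] [Algebra k B] (D : BialgData k B) (A : Type w)
    [CommRing A] [Algebra k A] : B →ₐ[k] A :=
  (Algebra.ofId k A).comp D.counit

section cv
variable {B : Type v} [CommRing B] [Algebra k B] (D : BialgData k B) {A : Type w}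
    [CommRing A] [Algebra k A] {A' : Type x} [CommRing A'] [Algebra k A']

theorem cv_assoc (f g h : B →ₐ[k] A) : cv D (cv D f g) h = cv D f (cv D g h) := by
  ext b
  let M : (B ⊗[k] B) ⊗[k] B →ₐ[k] A :=
    Algebra.TensorProduct.productMap (Algebra.TensorProduct.productMap f g) h
  have h1 : ∀ z, Algebra.TensorProduct.productMap (cv D f g) h z =
      M (TensorProduct.map D.comul.toLinearMap LinearMap.id z) := by
    intro z
    induction z using TensorProduct.induction_on with
    | zero => simp
    | add x y h h' => simp only [map_add, h, h']
    | tmul x y => simp [M, cv]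
  have h3 : ∀ w : B ⊗[k] (B ⊗[k] B), M ((TensorProduct.assoc k B B B).symm w) =
      Algebra.TensorProduct.productMap f (Algebra.TensorProduct.productMap g h) w := by
    intro w
    induction w using TensorProduct.induction_on with
    | zero => simp
    | add x y h h' => simp only [map_add, h, h']
    | tmul x y =>
      induction y using TensorProduct.induction_on with
      | zero => simp
      | add x y h h' => simp only [map_add, TensorProduct.tmul_add, h, h']
      | tmul y z => simp [M, mul_assoc]
  have h2 : ∀ z, Algebra.TensorProduct.productMap f (cv D g h) z =
      M ((TensorProduct.assoc k B B B).symm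
        (TensorProduct.map LinearMap.id D.comul.toLinearMap z)) := by
    intro z
    rw [h3]
    induction z using TensorProduct.induction_on with
    | zero => simp
    | add x y h h' => simp only [map_add, h, h']
    | tmul x y => simp [cv]
  change Algebra.TensorProduct.productMap (cv D f g) h (D.comul b) =
    Algebra.TensorProduct.productMap f (cv D g h) (D.comul b)
  rw [h1, h2, D.coassoc]

theorem one_cv (f : B →ₐ[k] A) : cv D (cv1 D A) f = f := by
  ext b
  have h : ∀ z, Algebra.TensorProduct.productMap (cv1 D A) f z =
      f (TensorProduct.lid k B (TensorProduct.map D.counit.toLinearMap LinearMap.id z)) := by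
    intro z
    induction z using TensorProduct.induction_on with
    | zero => simp
    | add x y h h' => simp only [map_add, h, h']
    | tmul x y => simp [cv1, Algebra.ofId_apply, Algebra.smul_def]
  change Algebra.TensorProduct.productMap (cv1 D A) f (D.comul b) = _
  rw [h, D.counit_comul]

theorem cv_one (f : B →ₐ[k] A) : cv D f (cv1 D A) = f := by
  ext b
  have h : ∀ z, Algebra.TensorProduct.productMap f (cv1 D A) z =
      f (TensorProduct.rid k B (TensorProduct.map LinearMap.id D.counit.toLinearMap z)) := by
    intro z
    induction z using TensorProduct.induction_on with
    | zero => simp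
    | add x y h h' => simp only [map_add, h, h']
    | tmul x y => simp [cv1, Algebra.ofId_apply, Algebra.smul_def, mul_comm]
  change Algebra.TensorProduct.productMap f (cv1 D A) (D.comul b) = _
  rw [h, D.comul_counit]

theorem comp_cv (j : A →ₐ[k] A') (f g : B →ₐ[k] A) :
    j.comp (cv D f g) = cv D (j.comp f) (j.comp g) := by
  rw [cv, cv, ← AlgHom.comp_assoc]
  congr 1
  ext <;> simp

theorem comp_cv1 (j : A →ₐ[k] A') : j.comp (cv1 D A) = cv1 D A' := by
  ext b; simp [cv1, Algebra.ofId_apply]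

/-- The key cancellation. -/
theorem cv_cancel {f1 f2 g1 g2 : B →ₐ[k] A} (h1 : cv D f1 g1 = cv1 D A) (h2 : cv D f2 g2 = cv1 D A) :
    cv D (cv D f1 f2) (cv D g2 g1) = cv1 D A := by
  rw [cv_assoc, ← cv_assoc D f2, h2, one_cv, h1]

end cv

end helpers

section nat
variable {k : Type u} [CommRing k] {A : Type v} {C : Type w} [CommRing A] [Algebra k A]
  [CommRing C] [Algebra k C] (f : A →ₐ[k] C) (dA : A →ₐ[k] A ⊗[k] A) (dC : C →ₐ[k] C ⊗[k] C)
  (h : ∀ a, Algebra.TensorProduct.map f f (dA a) = dC (f a))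

theorem nat1 (h : ∀ a, Algebra.TensorProduct.map f f (dA a) = dC (f a)) (z : A ⊗[k] A) :
    TensorProduct.map (Algebra.TensorProduct.map f f).toLinearMap f.toLinearMap
      (TensorProduct.map dA.toLinearMap LinearMap.id z) =
    TensorProduct.map dC.toLinearMap LinearMap.id (Algebra.TensorProduct.map f f z) := by
  induction z using TensorProduct.induction_on with
  | zero => simp only [map_zero]
  | add x y h h' => simp only [map_add, h, h']
  | tmul x y =>
    simp only [TensorProduct.map_tmul, Algebra.TensorProduct.map_tmul, AlgHom.toLinearMap_apply, h,
      LinearMap.id_apply]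

theorem nat3 (h : ∀ a, Algebra.TensorProduct.map f f (dA a) = dC (f a)) (z : A ⊗[k] A) :
    TensorProduct.map f.toLinearMap (Algebra.TensorProduct.map f f).toLinearMap
      (TensorProduct.map LinearMap.id dA.toLinearMap z) =
    TensorProduct.map LinearMap.id dC.toLinearMap (Algebra.TensorProduct.map f f z) := by
  induction z using TensorProduct.induction_on with
  | zero => simp only [map_zero]
  | add x y h h' => simp only [map_add, h, h']
  | tmul x y =>
    simp only [TensorProduct.map_tmul, Algebra.TensorProduct.map_tmul, AlgHom.toLinearMap_apply, h,
      LinearMap.id_apply]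

theorem nat2 (w : A ⊗[k] (A ⊗[k] A)) :
    TensorProduct.map (Algebra.TensorProduct.map f f).toLinearMap f.toLinearMap
      ((TensorProduct.assoc k A A A).symm w) =
    (TensorProduct.assoc k C C C).symm
      (TensorProduct.map f.toLinearMap (Algebra.TensorProduct.map f f).toLinearMap w) := by
  induction w using TensorProduct.induction_on with
  | zero => simp only [map_zero]
  | add x y h h' => simp only [map_add, h, h']
  | tmul x y =>
    induction y using TensorProduct.induction_on with
    | zero => simp only [map_zero, TensorProduct.tmul_zero]
    | add x y h h' => simp only [map_add, TensorProduct.tmul_add, h, h']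
    | tmul y z =>
      simp only [TensorProduct.assoc_symm_tmul, TensorProduct.map_tmul, AlgHom.toLinearMap_apply,
        Algebra.TensorProduct.map_tmul]

theorem nat4 (eA : A →ₐ[k] k) (eC : C →ₐ[k] k) (h : ∀ a, eC (f a) = eA a) (z : A ⊗[k] A) :
    f (TensorProduct.lid k A (TensorProduct.map eA.toLinearMap LinearMap.id z)) =
    TensorProduct.lid k C (TensorProduct.map eC.toLinearMap LinearMap.id
      (Algebra.TensorProduct.map f f z)) := by
  induction z using TensorProduct.induction_on with
  | zero => simp only [map_zero]
  | add x y h h' => simp only [map_add, h, h']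
  | tmul x y => simp [h]

theorem nat5 (eA : A →ₐ[k] k) (eC : C →ₐ[k] k) (h : ∀ a, eC (f a) = eA a) (z : A ⊗[k] A) :
    f (TensorProduct.rid k A (TensorProduct.map LinearMap.id eA.toLinearMap z)) =
    TensorProduct.rid k C (TensorProduct.map LinearMap.id eC.toLinearMap
      (Algebra.TensorProduct.map f f z)) := by
  induction z using TensorProduct.induction_on with
  | zero => simp only [map_zero]
  | add x y h h' => simp only [map_add, h, h']
  | tmul x y => simp [h]

theorem bialg_push (DA : BialgData k A) (hf : Function.Surjective f) (eC : C →ₐ[k] k)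
    (h : ∀ a, Algebra.TensorProduct.map f f (DA.comul a) = dC (f a))
    (he : ∀ a, eC (f a) = DA.counit a) :
    ∃ D : BialgData k C, D.comul = dC ∧ D.counit = eC := by
  refine ⟨⟨dC, eC, ?_, ?_, ?_⟩, rfl, rfl⟩
  · intro b
    obtain ⟨b, rfl⟩ := hf b
    rw [← h, ← nat1 f _ _ h, ← nat3 f _ _ h, ← nat2, DA.coassoc]
  · intro b
    obtain ⟨b, rfl⟩ := hf b
    rw [← h, ← nat4 f _ _ he, DA.counit_comul]
  · intro b
    obtain ⟨b, rfl⟩ := hf b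
    rw [← h, ← nat5 f _ _ he, DA.comul_counit]

end nat

theorem bialg_pull {k : Type u} [Field k] {A : Type v} {C : Type w} [CommRing A] [Algebra k A]
    [CommRing C] [Algebra k C] (DC : BialgData k C) (f : A →ₐ[k] C) (hf : Function.Injective f)
    (dA : A →ₐ[k] A ⊗[k] A)
    (h : ∀ a, Algebra.TensorProduct.map f f (dA a) = DC.comul (f a)) :
    ∃ D : BialgData k A, D.comul = dA ∧ D.counit = DC.counit.comp f := by
  refine ⟨⟨dA, DC.counit.comp f, ?_, ?_, ?_⟩, rfl, rfl⟩
  · intro b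
    have hi : Function.Injective (TensorProduct.map
        (Algebra.TensorProduct.map f f).toLinearMap f.toLinearMap) :=
      TensorProduct.map_injective_of_flat_flat _ _
        (TensorProduct.map_injective_of_flat_flat f.toLinearMap f.toLinearMap hf hf) hf
    apply hi
    rw [nat1 f _ _ h, nat2, nat3 f _ _ h, h, DC.coassoc]
  · intro b
    apply hf
    rw [nat4 f _ DC.counit (fun _ => rfl), h, DC.counit_comul]
  · intro b
    apply hf
    rw [nat5 f _ DC.counit (fun _ => rfl), h, DC.comul_counit]

section gen

theorem exists_tensor_pull {k : Type u} [Field k] {A : Type v} {B : Type w} [CommRing A] [Algebra k A]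
    [CommRing B] [Algebra k B]
    {PA : PoissonStr k A} {PB : PoissonStr k B} {TB : PoissonStr k (B ⊗[k] B)}
    (hB : IsTensorPoissonStr PB PB TB) (f : A →ₐ[k] B) (hf : IsPoissonHom PA PB f)
    (hinj : Function.Injective f) :
    Function.Injective (Algebra.TensorProduct.map f f) ∧
    (∀ a b, ∃ c, Algebra.TensorProduct.map f f c =
      TB.br (Algebra.TensorProduct.map f f a) (Algebra.TensorProduct.map f f b)) ∧
    ∃ TA : PoissonStr k (A ⊗[k] A), IsTensorPoissonStr PA PA TA := by
  set F := Algebra.TensorProduct.map f f with hF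
  have hFi : Function.Injective F :=
    TensorProduct.map_injective_of_flat_flat f.toLinearMap f.toLinearMap hinj hinj
  have hr : ∀ a b, ∃ c, F c = TB.br (F a) (F b) := by
    intro x y
    induction x using TensorProduct.induction_on with
    | zero => exact ⟨0, by simp⟩
    | add x x' h h' =>
      obtain ⟨c, hc⟩ := h
      obtain ⟨c', hc'⟩ := h'
      exact ⟨c + c', by simp [hc, hc']⟩
    | tmul p q =>
      induction y using TensorProduct.induction_on with
      | zero => exact ⟨0, by simp⟩
      | add x x' h h' =>
        obtain ⟨c, hc⟩ := h
        obtain ⟨c', hc'⟩ := h'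
        exact ⟨c + c', by simp [hc, hc']⟩
      | tmul r s =>
        refine ⟨(p * r) ⊗ₜ PA.br q s + PA.br p r ⊗ₜ (q * s), ?_⟩
        simp only [F, Algebra.TensorProduct.map_tmul, map_add, map_mul]
        rw [hB, hf, hf]
  refine ⟨hFi, hr, ?_⟩
  obtain ⟨TA, hTA⟩ := exists_pull TB F hFi hr
  refine ⟨TA, ?_⟩
  intro p r q s
  apply hFi
  rw [hTA]
  simp only [F, Algebra.TensorProduct.map_tmul, map_add, map_mul]
  rw [hB, hf, hf]

theorem gen_top {k B C : Type u} [Field k]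
    [CommRing B] [Algebra k B] [CommRing C] [Algebra k C]
    (PB : PoissonStr k B) (DB : BialgData k B)
    (PC : PoissonStr k C) (DC : BialgData k C) (hC : IsPoissonBialg PC DC)
    (q : ℕ → (B →ₐ[k] C))
    (heven : ∀ n, Even n → IsPoissonBialgHom PB PC DB DC (q n))
    (hodd : ∀ n, ¬ Even n → IsOpPoissonBialgHom PB PC DB DC (q n))
    (hcoprod : ∀ (R : PoissonBialgBundle.{u, u} k) (u' : ℕ → (B →ₐ[k] R.carrier)),
      (∀ n, Even n → IsPoissonBialgHom PB R.str DB R.bi (u' n)) →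
      (∀ n, ¬ Even n → IsOpPoissonBialgHom PB R.str DB R.bi (u' n)) →
      ∃! v : C →ₐ[k] R.carrier,
        IsPoissonBialgHom PC R.str DC R.bi v ∧ ∀ n x, v (q n x) = u' n x)
    (W : Subalgebra k C) (hWq : ∀ n x, q n x ∈ W)
    (hWb : ∀ a ∈ W, ∀ b ∈ W, PC.br a b ∈ W) (c : C) : c ∈ W := by
  have hC' := hC
  obtain ⟨T, hT, hTc⟩ := hC'
  obtain ⟨C0, hqC0, hbC0, hmin⟩ : ∃ C0 : Subalgebra k C, (∀ n x, q n x ∈ C0) ∧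
      (∀ a ∈ C0, ∀ b ∈ C0, PC.br a b ∈ C0) ∧
      ∀ V : Subalgebra k C, (∀ n x, q n x ∈ V) → (∀ a ∈ V, ∀ b ∈ V, PC.br a b ∈ V) → C0 ≤ V := by
    refine ⟨sInf {V : Subalgebra k C | (∀ n x, q n x ∈ V) ∧ (∀ a ∈ V, ∀ b ∈ V, PC.br a b ∈ V)},
      ?_, ?_, ?_⟩
    · intro n x
      rw [Algebra.mem_sInf]
      exact fun V hV => hV.1 n x
    · intro a ha b hb
      rw [Algebra.mem_sInf] at *
      exact fun V hV => hV.2 a (ha V hV) b (hb V hV)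
    · intro V h1 h2
      exact sInf_le ⟨h1, h2⟩
  let f : C0 →ₐ[k] C := C0.val
  have hfi : Function.Injective f := Subtype.val_injective
  obtain ⟨P0, hP0⟩ := exists_pull PC f hfi (fun a b => ⟨⟨_, hbC0 _ a.2 _ b.2⟩, rfl⟩)
  obtain ⟨hFi, hFr, T0, hT0⟩ := exists_tensor_pull hT f hP0 hfi
  set F := Algebra.TensorProduct.map f f with hF
  have hle : C0 ≤ F.range.comap DC.comul := by
    apply hmin
    · intro n x
      have aux : ∀ z, ∃ c, F c = TensorProduct.map (q n).toLinearMap (q n).toLinearMap z := by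
        intro z
        induction z using TensorProduct.induction_on with
        | zero => exact ⟨0, by simp⟩
        | add x x' h h' =>
          obtain ⟨c, hc⟩ := h
          obtain ⟨c', hc'⟩ := h'
          exact ⟨c + c', by simp [hc, hc']⟩
        | tmul x y => exact ⟨⟨_, hqC0 n x⟩ ⊗ₜ ⟨_, hqC0 n y⟩, rfl⟩
      change DC.comul (q n x) ∈ F.range
      by_cases hn : Even n
      · rw [(heven n hn).2.1]
        exact aux _
      · rw [(hodd n hn).2.1]
        rw [← TensorProduct.map_comm]
        exact aux _
    · rintro a ⟨a', ha⟩ b ⟨b', hb⟩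
      change DC.comul (PC.br a b) ∈ F.range
      rw [hTc]
      obtain ⟨c, hc⟩ := hFr a' b'
      refine ⟨c, ?_⟩
      change F c = _
      rw [hc]
      change F a' = _ at ha
      change F b' = _ at hb
      rw [ha, hb]
      rfl
  obtain ⟨Δ0, hΔ0⟩ : ∃ Δ0 : C0 →ₐ[k] C0 ⊗[k] C0, ∀ z, F (Δ0 z) = DC.comul (f z) := by
    let g : C0 →ₐ[k] F.range := (DC.comul.comp f).codRestrict F.range (fun z => hle z.2)
    refine ⟨(AlgEquiv.ofInjective F hFi).symm.toAlgHom.comp g, fun z => ?_⟩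
    have := (AlgEquiv.ofInjective F hFi).apply_symm_apply (g z)
    exact congrArg Subtype.val this
  have hFlin : ∀ z, TensorProduct.map f.toLinearMap f.toLinearMap z = F z := fun z => rfl
  obtain ⟨D0, hD0, hD0e⟩ := bialg_pull DC f hfi Δ0 hΔ0
  have hFP := map_poisson hT0 hT f hP0
  have hcompat : IsPoissonBialg P0 D0 := by
    refine ⟨T0, hT0, fun a b => hFi ?_⟩
    rw [hD0, hFP, ← hF, hΔ0, hΔ0, hΔ0, hP0, hTc]
  let R : PoissonBialgBundle.{u, u} k :=
    { carrier := C0, str := P0, bi := D0, compat := hcompat }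
  let u' : ℕ → (B →ₐ[k] C0) := fun n => (q n).codRestrict C0 (hqC0 n)
  have hu' : ∀ n x, f (u' n x) = q n x := fun n x => rfl
  have hmm : ∀ n z, F (TensorProduct.map (u' n).toLinearMap (u' n).toLinearMap z) =
      TensorProduct.map (q n).toLinearMap (q n).toLinearMap z := by
    intro n z
    induction z using TensorProduct.induction_on with
    | zero => simp
    | add x y h h' => simp only [map_add, h, h']
    | tmul x y => simp [F, hu']
  obtain ⟨v, ⟨hv, hvq⟩, -⟩ := hcoprod R u'
    (by
      intro n hn
      obtain ⟨h1, h2, h3⟩ := heven n hn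
      refine ⟨fun a b => hfi ?_, fun a => hFi ?_, fun a => ?_⟩
      · change f (u' n _) = f (P0.br (u' n a) (u' n b))
        rw [hP0, hu', hu', hu', h1]
      · change F (D0.comul (u' n a)) = F (TensorProduct.map (u' n).toLinearMap (u' n).toLinearMap _)
        rw [hD0, hΔ0, hu', hmm, h2]
      · change D0.counit (u' n a) = _
        rw [hD0e]
        exact h3 a)
    (by
      intro n hn
      obtain ⟨h1, h2, h3⟩ := hodd n hn
      refine ⟨fun a b => hfi ?_, fun a => hFi ?_, fun a => ?_⟩
      · change f (u' n _) = f (P0.br (u' n b) (u' n a))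
        rw [hP0, hu', hu', hu', h1]
      · change F (D0.comul (u' n a)) = F (TensorProduct.comm k C0 C0
          (TensorProduct.map (u' n).toLinearMap (u' n).toLinearMap _))
        rw [hD0, hΔ0, hu', ← TensorProduct.map_comm, hmm, h2, TensorProduct.map_comm]
      · change D0.counit (u' n a) = _
        rw [hD0e]
        exact h3 a)
  obtain ⟨w, -, hw⟩ := hcoprod { carrier := C, str := PC, bi := DC, compat := hC } q heven hodd
  have e1 : AlgHom.id k C = w := hw _ ⟨⟨fun a b => rfl, fun a => by
      change DC.comul a = TensorProduct.map LinearMap.id LinearMap.id (DC.comul a)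
      rw [TensorProduct.map_id]; rfl, fun a => rfl⟩, fun n x => rfl⟩
  let v' : C →ₐ[k] C0 := v
  have e2 : f.comp v' = w := by
    apply hw
    refine ⟨⟨fun a b => ?_, fun a => ?_, fun a => ?_⟩, fun n x => ?_⟩
    · have := hv.1 a b
      change f (v' _) = PC.br (f (v' a)) (f (v' b))
      rw [← hP0]
      exact congrArg f this
    · change DC.comul (f (v' a)) = _
      rw [← hΔ0]
      have := hv.2.1 a
      change D0.comul (v' a) = TensorProduct.map v'.toLinearMap v'.toLinearMap _ at this
      rw [← hD0, this]
      have e : ∀ z, F (TensorProduct.map v'.toLinearMap v'.toLinearMap z) =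
        TensorProduct.map (f.comp v').toLinearMap (f.comp v').toLinearMap z := by
        intro z
        induction z using TensorProduct.induction_on with
        | zero => simp
        | add x y h h' => simp only [map_add, h, h']
        | tmul x y => simp [F]
      exact e _
    · have := hv.2.2 a
      change D0.counit (v' a) = _ at this
      rw [hD0e] at this
      exact this
    · exact congrArg f (hvq n x)
  have : f (v' c) = c := by
    have := DFunLike.congr_fun (e2.trans e1.symm) c
    exact this
  rw [← this]
  exact hmin W hWq hWb (v' c).2

end gen

section gens
variable {k : Type u} [CommRing k]

theorem conv_br {C : Type v} {Q : Type w} [CommRing C] [Algebra k C] [CommRing Q] [Algebra k Q]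
    {P : PoissonStr k C} {PQ : PoissonStr k Q} {T : PoissonStr k (C ⊗[k] C)}
    (hT : IsTensorPoissonStr P P T) (α β : C →ₐ[k] Q) (e : k)
    (hα : ∀ a b, α (P.br a b) = - e • PQ.br (α a) (α b))
    (hβ : ∀ a b, β (P.br a b) = e • PQ.br (β a) (β b)) (x y : C ⊗[k] C) :
    Algebra.TensorProduct.productMap α β (T.br x y) =
      e • (LinearMap.mul' k Q (TensorProduct.map α.toLinearMap
          (PQ.br.flip (Algebra.TensorProduct.productMap α β y) ∘ₗ β.toLinearMap) x) -
        LinearMap.mul' k Q (TensorProduct.map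
          (PQ.br (Algebra.TensorProduct.productMap α β x) ∘ₗ α.toLinearMap) β.toLinearMap y)) := by
  induction x using TensorProduct.induction_on with
  | zero => simp
  | add x x' h h' =>
    simp only [map_add, LinearMap.add_apply, h, h', LinearMap.add_comp, TensorProduct.map_add_left,
      ← smul_add]
    congr 1
    ring
  | tmul p q =>
    induction y using TensorProduct.induction_on with
    | zero => simp
    | add x x' h h' =>
      simp only [map_add, h, h', LinearMap.add_comp, TensorProduct.map_add_right, LinearMap.add_apply,
        ← smul_add]
      congr 1
      ring
    | tmul r s =>
      rw [hT]
      simp only [map_add, Algebra.TensorProduct.productMap_apply_tmul, hα, hβ, map_mul,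
        TensorProduct.map_tmul, LinearMap.mul'_apply, LinearMap.comp_apply, LinearMap.flip_apply,
        AlgHom.toLinearMap_apply, PQ.leibniz]
      rw [PQ.skew (α p * β q) (α r), PQ.leibniz, PQ.skew (α r) (α p), PQ.skew (α r) (β q)]
      simp only [Algebra.smul_def, map_neg]
      ring

theorem conv_br_zero {C : Type v} {Q : Type w} [CommRing C] [Algebra k C] [CommRing Q] [Algebra k Q]
    {P : PoissonStr k C} {PQ : PoissonStr k Q} {D : BialgData k C}
    (hD : IsPoissonBialg P D) (α β : C →ₐ[k] Q) (e : k)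
    (hα : ∀ a b, α (P.br a b) = - e • PQ.br (α a) (α b))
    (hβ : ∀ a b, β (P.br a b) = e • PQ.br (β a) (β b)) (a b : C)
    (ha : cv D α β a = cv1 D Q a) (hb : cv D α β b = cv1 D Q b) :
    cv D α β (P.br a b) = cv1 D Q (P.br a b) := by
  have hc := counit_br hD a b
  obtain ⟨T, hT, hTc⟩ := hD
  have ha' : Algebra.TensorProduct.productMap α β (D.comul a) = algebraMap k Q (D.counit a) := ha
  have hb' : Algebra.TensorProduct.productMap α β (D.comul b) = algebraMap k Q (D.counit b) := hb
  change Algebra.TensorProduct.productMap α β (D.comul (P.br a b)) = algebraMap k Q (D.counit _)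
  have z1 : ∀ r : k, PQ.br.flip (algebraMap k Q r) = 0 := by
    intro r; ext x; exact PQ.br_algebraMap x r
  have z2 : ∀ r : k, PQ.br (algebraMap k Q r) = 0 := by
    intro r; ext x; rw [PQ.skew, PQ.br_algebraMap]; simp
  rw [hc, hTc, conv_br hT α β e hα hβ, ha', hb', z1, z2]
  simp

theorem pm_map {B : Type v} {C : Type w} {A : Type x} [CommRing B] [Algebra k B] [CommRing C]
    [Algebra k C] [CommRing A] [Algebra k A] (f g : C →ₐ[k] A) (q : B →ₐ[k] C) (z : B ⊗[k] B) :
    Algebra.TensorProduct.productMap f g (TensorProduct.map q.toLinearMap q.toLinearMap z) =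
      Algebra.TensorProduct.productMap (f.comp q) (g.comp q) z := by
  induction z using TensorProduct.induction_on with
  | zero => simp only [map_zero]
  | add x y h h' => simp only [map_add, h, h']
  | tmul x y => simp

theorem pm_comm {C : Type w} {A : Type x} [CommRing C]
    [Algebra k C] [CommRing A] [Algebra k A] (f g : C →ₐ[k] A) (z : C ⊗[k] C) :
    Algebra.TensorProduct.productMap f g (TensorProduct.comm k C C z) =
      Algebra.TensorProduct.productMap g f z := by
  induction z using TensorProduct.induction_on with
  | zero => simp only [map_zero]
  | add x y h h' => simp only [map_add, h, h']
  | tmul x y => simp [mul_comm]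

theorem genL_apply {C : Type w} {A : Type x} [CommRing C]
    [Algebra k C] [CommRing A] [Algebra k A] (D : BialgData k C) (h : C →ₐ[k] A) (S : C →ₐ[k] C)
    (c : C) :
    h (LinearMap.mul' k C (TensorProduct.map S.toLinearMap LinearMap.id (D.comul c))) =
      cv D (h.comp S) h c := by
  change _ = Algebra.TensorProduct.productMap (h.comp S) h (D.comul c)
  generalize D.comul c = z
  induction z using TensorProduct.induction_on with
  | zero => simp only [map_zero]
  | add x y h h' => simp only [map_add, h, h']
  | tmul x y => simp

theorem genR_apply {C : Type w} {A : Type x} [CommRing C]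
    [Algebra k C] [CommRing A] [Algebra k A] (D : BialgData k C) (h : C →ₐ[k] A) (S : C →ₐ[k] C)
    (c : C) :
    h (LinearMap.mul' k C (TensorProduct.map LinearMap.id S.toLinearMap (D.comul c))) =
      cv D h (h.comp S) c := by
  change _ = Algebra.TensorProduct.productMap h (h.comp S) (D.comul c)
  generalize D.comul c = z
  induction z using TensorProduct.induction_on with
  | zero => simp only [map_zero]
  | add x y h h' => simp only [map_add, h, h']
  | tmul x y => simp

/-- `q` is a coalgebra map or an anti-coalgebra map. -/
def CoOrOp {B : Type v} {C : Type w} [CommRing B] [Algebra k B] [CommRing C]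
    [Algebra k C] (DB : BialgData k B) (DC : BialgData k C) (q : B →ₐ[k] C) : Prop :=
  ((∀ x, DC.comul (q x) = TensorProduct.map q.toLinearMap q.toLinearMap (DB.comul x)) ∨
   (∀ x, DC.comul (q x) = TensorProduct.comm k C C
      (TensorProduct.map q.toLinearMap q.toLinearMap (DB.comul x)))) ∧
  ∀ x, DC.counit (q x) = DB.counit x

theorem coOrOp_cv {B : Type v} {C : Type w} {A : Type x} [CommRing B] [Algebra k B] [CommRing C]
    [Algebra k C] [CommRing A] [Algebra k A] {DB : BialgData k B} {DC : BialgData k C}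
    {q : B →ₐ[k] C} (hq : CoOrOp DB DC q) (f g : C →ₐ[k] A) :
    ((∀ x, cv DC f g (q x) = cv1 DC A (q x)) ∧ (∀ x, cv DC g f (q x) = cv1 DC A (q x))) ↔
    (cv DB (f.comp q) (g.comp q) = cv1 DB A ∧ cv DB (g.comp q) (f.comp q) = cv1 DB A) := by
  have h1 : ∀ x, cv1 DC A (q x) = cv1 DB A x := by
    intro x; simp [cv1, hq.2]
  simp only [DFunLike.ext_iff, h1]
  rcases hq.1 with h | h
  · have h2 : ∀ (f g : C →ₐ[k] A) x, cv DC f g (q x) = cv DB (f.comp q) (g.comp q) x := by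
      intro f g x
      simp only [cv, AlgHom.comp_apply, h, pm_map]
    simp only [h2]
  · have h2 : ∀ (f g : C →ₐ[k] A) x, cv DC f g (q x) = cv DB (g.comp q) (f.comp q) x := by
      intro f g x
      simp only [cv, AlgHom.comp_apply, h, pm_map, pm_comm]
    simp only [h2]
    exact and_comm

/-- for the (op)coalgebra map `q`, `(π ⊗ π) Δ q` is a convolution product. -/
theorem coOrOp_cases {B : Type v} {C : Type w} {A : Type x} [CommRing B] [Algebra k B] [CommRing C]
    [Algebra k C] [CommRing A] [Algebra k A] {DB : BialgData k B} {DC : BialgData k C}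
    (q : B →ₐ[k] C) (p : C →ₐ[k] A) :
    ((∀ x, DC.comul (q x) = TensorProduct.map q.toLinearMap q.toLinearMap (DB.comul x)) →
      ((Algebra.TensorProduct.map p p).comp DC.comul).comp q =
        cv DB (Algebra.TensorProduct.includeLeft.comp (p.comp q))
          (Algebra.TensorProduct.includeRight.comp (p.comp q))) ∧
    ((∀ x, DC.comul (q x) = TensorProduct.comm k C C
      (TensorProduct.map q.toLinearMap q.toLinearMap (DB.comul x))) →
      ((Algebra.TensorProduct.map p p).comp DC.comul).comp q =
        cv DB (Algebra.TensorProduct.includeRight.comp (p.comp q))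
          (Algebra.TensorProduct.includeLeft.comp (p.comp q))) := by
  constructor
  · intro h
    ext x
    simp only [cv, AlgHom.comp_apply, h]
    generalize DB.comul x = z
    induction z using TensorProduct.induction_on with
    | zero => simp only [map_zero]
    | add x y h h' => simp only [map_add, h, h']
    | tmul x y => simp
  · intro h
    ext x
    simp only [cv, AlgHom.comp_apply, h]
    generalize DB.comul x = z
    induction z using TensorProduct.induction_on with
    | zero => simp only [map_zero]
    | add x y h h' => simp only [map_add, h, h']
    | tmul x y => simp

end gens
/-- in the construction of the free Poisson Hopf algebra, the Poisson
ideal `𝓘` generated by the convolution relations is stable under `S'`: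
`S'(𝓘) ⊆ 𝓘`; consequently the quotient `C ⧸ 𝓘` carries a Poisson Hopf algebra
structure whose antipode is induced by `S'` (and whose bialgebra structure makes the
canonical projection a morphism of Poisson bialgebras). -/
theorem free_hopf_ideal_antipode_stable (k B C : Type u) [Field k]
    [CommRing B] [Algebra k B] [CommRing C] [Algebra k C]
    (PB : PoissonStr k B) (DB : BialgData k B) (hB : IsPoissonBialg PB DB)
    (PC : PoissonStr k C) (DC : BialgData k C) (hC : IsPoissonBialg PC DC)
    (q : ℕ → (B →ₐ[k] C))
    (heven : ∀ n, Even n → IsPoissonBialgHom PB PC DB DC (q n))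
    (hodd : ∀ n, ¬ Even n → IsOpPoissonBialgHom PB PC DB DC (q n))
    (hcoprod : ∀ (R : PoissonBialgBundle.{u, u} k) (u' : ℕ → (B →ₐ[k] R.carrier)),
      (∀ n, Even n → IsPoissonBialgHom PB R.str DB R.bi (u' n)) →
      (∀ n, ¬ Even n → IsOpPoissonBialgHom PB R.str DB R.bi (u' n)) →
      ∃! v : C →ₐ[k] R.carrier,
        IsPoissonBialgHom PC R.str DC R.bi v ∧ ∀ n x, v (q n x) = u' n x)
    (S' : C →ₐ[k] C)
    (hS'q : ∀ (n : ℕ) (x : B), S' (q n x) = q (n + 1) x)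
    (hS' : IsOpPoissonBialgHom PC PC DC DC S')
    (I : Ideal C)
    (hIdef : I = poissonIdealGen PC {y : C | ∃ (n : ℕ) (x : B),
      y = LinearMap.mul' k C
            (TensorProduct.map S'.toLinearMap LinearMap.id (DC.comul (q n x))) -
          algebraMap k C (DC.counit (q n x)) ∨
      y = LinearMap.mul' k C
            (TensorProduct.map LinearMap.id S'.toLinearMap (DC.comul (q n x))) -
          algebraMap k C (DC.counit (q n x))}) :
    (∀ y ∈ I, S' y ∈ I) ∧
    ∃ (QS : PoissonStr k (C ⧸ I)) (D' : HopfData k (C ⧸ I)),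
      IsPoissonBialg QS D'.toBialgData ∧
      IsPoissonBialgHom PC QS DC D'.toBialgData (Ideal.Quotient.mkₐ k I) ∧
      ∀ c : C, D'.antipode (Ideal.Quotient.mkₐ k I c) = Ideal.Quotient.mkₐ k I (S' c) := by
  have hC' := hC
  obtain ⟨T, hT, hTc⟩ := hC'
  have hco : ∀ n, CoOrOp DB DC (q n) := by
    intro n
    by_cases hn : Even n
    · exact ⟨Or.inl (heven n hn).2.1, (heven n hn).2.2⟩
    · exact ⟨Or.inr (hodd n hn).2.1, (hodd n hn).2.2⟩
  have hSq : ∀ n, S'.comp (q n) = q (n + 1) := fun n => AlgHom.ext (hS'q n)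
  let π : C →ₐ[k] C ⧸ I := Ideal.Quotient.mkₐ k I
  have hπs : Function.Surjective π := Ideal.Quotient.mkₐ_surjective k I
  have hπ0 : ∀ a, π a = 0 ↔ a ∈ I := fun a => Ideal.Quotient.eq_zero_iff_mem
  -- the ideal is a Poisson ideal
  have hIP : IsPoissonIdeal PC I := by
    subst hIdef
    intro p a ha
    simp only [poissonIdealGen, Submodule.mem_sInf] at ha ⊢
    exact fun J hJ => hJ.2 p a (ha J hJ)
  -- the generators, killed by the projection
  have hπgood : ∀ n, cv DB (π.comp (q (n + 1))) (π.comp (q n)) = cv1 DB _ ∧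
      cv DB (π.comp (q n)) (π.comp (q (n + 1))) = cv1 DB _ := by
    intro n
    rw [← hSq, ← AlgHom.comp_assoc]
    rw [← coOrOp_cv (hco n) (π.comp S') π]
    have hmem : ∀ y, y ∈ {y : C | ∃ (n : ℕ) (x : B),
      y = LinearMap.mul' k C
            (TensorProduct.map S'.toLinearMap LinearMap.id (DC.comul (q n x))) -
          algebraMap k C (DC.counit (q n x)) ∨
      y = LinearMap.mul' k C
            (TensorProduct.map LinearMap.id S'.toLinearMap (DC.comul (q n x))) -
          algebraMap k C (DC.counit (q n x))} → π y = 0 := by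
      intro y hy
      rw [hπ0, hIdef]
      simp only [poissonIdealGen, Submodule.mem_sInf]
      exact fun J hJ => hJ.1 hy
    constructor
    · intro x
      have := hmem _ ⟨n, x, Or.inl rfl⟩
      rw [map_sub, sub_eq_zero, genL_apply, AlgHom.commutes] at this
      exact this
    · intro x
      have := hmem _ ⟨n, x, Or.inr rfl⟩
      rw [map_sub, sub_eq_zero, genR_apply, AlgHom.commutes] at this
      exact this
  -- universal property of the ideal
  have hImin : ∀ (A : Type u) [CommRing A] [Algebra k A] (h : C →ₐ[k] A),
      (∀ p a, h a = 0 → h (PC.br p a) = 0) →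
      (∀ n, cv DB (h.comp (q (n + 1))) (h.comp (q n)) = cv1 DB _ ∧
        cv DB (h.comp (q n)) (h.comp (q (n + 1))) = cv1 DB _) → ∀ a ∈ I, h a = 0 := by
    intro A _ _ h hker hgood
    suffices hle : I ≤ RingHom.ker h from fun a ha => hle ha
    rw [hIdef]
    apply sInf_le
    refine ⟨?_, fun p a ha => hker p a ha⟩
    rintro y ⟨n, x, hy⟩
    have hg := hgood n
    rw [← hSq, ← AlgHom.comp_assoc, ← coOrOp_cv (hco n) (h.comp S') h] at hg
    change h y = 0
    rcases hy with rfl | rfl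
    · rw [map_sub, sub_eq_zero, genL_apply, AlgHom.commutes]
      exact hg.1 x
    · rw [map_sub, sub_eq_zero, genR_apply, AlgHom.commutes]
      exact hg.2 x
  have hbr : ∀ p a, π a = 0 → π (PC.br p a) = 0 := fun p a ha =>
    (hπ0 _).2 (hIP p a ((hπ0 a).1 ha))
  have hS0 : ∀ y ∈ I, (π.comp S') y = 0 := by
    apply hImin _ (π.comp S')
    · intro p a ha
      have ha' : π (S' a) = 0 := ha
      change π (S' (PC.br p a)) = 0
      rw [hS'.1, PC.skew, map_neg, hbr _ _ ha', neg_zero]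
    · intro n
      rw [AlgHom.comp_assoc, AlgHom.comp_assoc, hSq, hSq]
      exact hπgood (n + 1)
  refine ⟨fun y hy => (hπ0 _).1 (hS0 y hy), ?_⟩
  obtain ⟨QS, hQS⟩ := exists_push PC π hπs hbr
  obtain ⟨TQ, hTQ⟩ := exists_tensor_push hT π hQS hπs
  have hππ := map_poisson hT hTQ π hQS
  -- the comultiplication descends
  let Φ : C →ₐ[k] (C ⧸ I) ⊗[k] (C ⧸ I) := (Algebra.TensorProduct.map π π).comp DC.comul
  have hΦ0 : ∀ a ∈ I, Φ a = 0 := by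
    apply hImin _ Φ
    · intro p a ha
      have ha' : Algebra.TensorProduct.map π π (DC.comul a) = 0 := ha
      change Algebra.TensorProduct.map π π (DC.comul (PC.br p a)) = 0
      rw [hTc, hππ, ha', map_zero]
    · intro n
      have hl : ∀ f g : B →ₐ[k] C ⧸ I, cv DB f g = cv1 DB _ →
          cv DB ((Algebra.TensorProduct.includeLeft :
            C ⧸ I →ₐ[k] (C ⧸ I) ⊗[k] (C ⧸ I)).comp f)
            (Algebra.TensorProduct.includeLeft.comp g) = cv1 DB _ := by
        intro f g h
        rw [← comp_cv, h, comp_cv1]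
      have hr : ∀ f g : B →ₐ[k] C ⧸ I, cv DB f g = cv1 DB _ →
          cv DB ((Algebra.TensorProduct.includeRight :
            C ⧸ I →ₐ[k] (C ⧸ I) ⊗[k] (C ⧸ I)).comp f)
            (Algebra.TensorProduct.includeRight.comp g) = cv1 DB _ := by
        intro f g h
        rw [← comp_cv, h, comp_cv1]
      obtain ⟨g1, g2⟩ := hπgood n
      by_cases hn : Even n
      · have hn' : ¬ Even (n + 1) := by rw [Nat.even_add_one]; exact not_not.2 hn
        rw [(coOrOp_cases (q n) π).1 (heven n hn).2.1,
          (coOrOp_cases (q (n + 1)) π).2 (hodd _ hn').2.1]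
        exact ⟨cv_cancel DB (hr _ _ g1) (hl _ _ g1), cv_cancel DB (hl _ _ g2) (hr _ _ g2)⟩
      · have hn' : Even (n + 1) := by rw [Nat.even_add_one]; exact hn
        rw [(coOrOp_cases (q n) π).2 (hodd n hn).2.1,
          (coOrOp_cases (q (n + 1)) π).1 (heven _ hn').2.1]
        exact ⟨cv_cancel DB (hl _ _ g1) (hr _ _ g1), cv_cancel DB (hr _ _ g2) (hl _ _ g2)⟩
  -- the counit descends
  have hε0 : ∀ a ∈ I, DC.counit a = 0 := by
    apply hImin _ DC.counit
    · intro p a _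
      exact counit_br hC p a
    · intro n
      have h1 : ∀ n, DC.counit.comp (q n) = cv1 DB k := by
        intro n
        ext x
        exact (hco n).2 x
      rw [h1, h1, one_cv]
      exact ⟨rfl, rfl⟩
  let dQ : C ⧸ I →ₐ[k] (C ⧸ I) ⊗[k] (C ⧸ I) := Ideal.Quotient.liftₐ I Φ hΦ0
  let eQ : C ⧸ I →ₐ[k] k := Ideal.Quotient.liftₐ I DC.counit hε0
  let sQ : C ⧸ I →ₐ[k] C ⧸ I := Ideal.Quotient.liftₐ I (π.comp S') hS0
  have hd : ∀ a, Algebra.TensorProduct.map π π (DC.comul a) = dQ (π a) := fun a => rfl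
  have he : ∀ a, eQ (π a) = DC.counit a := fun a => rfl
  have hs : ∀ a, sQ (π a) = π (S' a) := fun a => rfl
  obtain ⟨D, hD1, hD2⟩ := bialg_push π dQ DC hπs eQ hd he
  -- the antipode relations hold everywhere
  have hanti : ∀ c, cv DC (π.comp S') π c = cv1 DC _ c ∧ cv DC π (π.comp S') c = cv1 DC _ c := by
    have hσ : ∀ a b, (π.comp S') (PC.br a b) = (-1 : k) • QS.br ((π.comp S') a) ((π.comp S') b) := by
      intro a b
      change π (S' _) = (-1 : k) • QS.br (π (S' a)) (π (S' b))
      rw [hS'.1, hQS, QS.skew, neg_one_smul]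
    have hπ1 : ∀ a b, π (PC.br a b) = (1 : k) • QS.br (π a) (π b) := by
      intro a b
      rw [one_smul, hQS]
    have hq' := fun n => (coOrOp_cv (hco n) (π.comp S') π).2 (by
      rw [AlgHom.comp_assoc, hSq]; exact hπgood n)
    intro c
    constructor
    · refine gen_top PB DB PC DC hC q heven hodd hcoprod
        (AlgHom.equalizer (cv DC (π.comp S') π) (cv1 DC _)) (fun n x => (hq' n).1 x) ?_ c
      intro a ha b hb
      exact conv_br_zero hC (π.comp S') π 1 hσ hπ1 a b ha hb
    · refine gen_top PB DB PC DC hC q heven hodd hcoprod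
        (AlgHom.equalizer (cv DC π (π.comp S')) (cv1 DC _)) (fun n x => (hq' n).2 x) ?_ c
      intro a ha b hb
      exact conv_br_zero hC π (π.comp S') (-1) (by simpa using hπ1) hσ a b ha hb
  have hmul1 : ∀ z, LinearMap.mul' k (C ⧸ I) (TensorProduct.map sQ.toLinearMap LinearMap.id
      (Algebra.TensorProduct.map π π z)) =
      Algebra.TensorProduct.productMap (π.comp S') π z := by
    intro z
    induction z using TensorProduct.induction_on with
    | zero => simp only [map_zero]
    | add x y h h' => simp only [map_add, h, h']
    | tmul x y => rfl
  have hmul2 : ∀ z, LinearMap.mul' k (C ⧸ I) (TensorProduct.map LinearMap.id sQ.toLinearMap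
      (Algebra.TensorProduct.map π π z)) =
      Algebra.TensorProduct.productMap π (π.comp S') z := by
    intro z
    induction z using TensorProduct.induction_on with
    | zero => simp only [map_zero]
    | add x y h h' => simp only [map_add, h, h']
    | tmul x y => rfl
  refine ⟨QS, ⟨D, sQ.toLinearMap, ?_, ?_⟩, ⟨TQ, hTQ, ?_⟩, ⟨hQS, ?_, ?_⟩, fun c => hs c⟩
  · intro b
    obtain ⟨b, rfl⟩ := hπs b
    rw [hD1, hD2, ← hd, he, hmul1]
    exact (hanti b).1
  · intro b
    obtain ⟨b, rfl⟩ := hπs b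
    rw [hD1, hD2, ← hd, he, hmul2]
    exact (hanti b).2
  · intro a b
    obtain ⟨a, rfl⟩ := hπs a
    obtain ⟨b, rfl⟩ := hπs b
    change D.comul _ = TQ.br (D.comul _) (D.comul _)
    rw [hD1, ← hQS, ← hd, ← hd, ← hd, hTc, hππ]
  · intro a
    change D.comul (π a) = _
    rw [hD1, ← hd]
    rfl
  · intro a
    change D.counit (π a) = _
    rw [hD2, he]
end
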